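/- arXiv:1902.08435 — 2 statements merged into one kernel-verified Lean document; each statement's English description precedes it below -/
import Mathlib

section
/- Let δ ∈ (0, 1/6) be fixed. Then #{E_{A,B} ∈ 𝓕(X) : sq(Δ(E_{A,B})) > 4X^δ} ≪ X^{5/6 − 5δ/6}, with implied constant depending only on δ. -/
/-- Membership in the family 𝓕 : the discriminant condition and minimality condition. -/
def inFamily (A B : ℤ) : Prop :=
  4 * A ^ 3 + 27 * B ^ 2 ≠ 0 ∧
    ∀ p : ℕ, p.Prime → ¬((p : ℤ) ^ 4 ∣ A ∧ (p : ℤ) ^ 6 ∣ B)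

/-- The height `H(E_{A,B}) = max {4|A|³, 27B²}`. -/
def Eheight (A B : ℤ) : ℤ := max (4 * |A| ^ 3) (27 * B ^ 2)

/-- The family 𝓕(X), identified with the set of parameters `(A, B)`. -/
def FX (X : ℝ) : Set (ℤ × ℤ) :=
  {p | inFamily p.1 p.2 ∧ (Eheight p.1 p.2 : ℝ) ≤ X}

/-- The discriminant `Δ(E_{A,B}) = -16(4A³ + 27B²)`. -/
def discAB (A B : ℤ) : ℤ := -16 * (4 * A ^ 3 + 27 * B ^ 2)

/-- For `n ≠ 0`, `sqPart n` is the unique `ℓ ≥ 1` such that `n = m ℓ²` with `m` squarefree,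
namely `∏ p, p ^ (v_p(n) / 2)`. -/
def sqPart (n : ℤ) : ℕ := n.natAbs.factorization.prod fun p e => p ^ (e / 2)

/-- The subfamily 𝓕_δ(X). -/
def Fdelta (δ X : ℝ) : Set (ℤ × ℤ) :=
  {p ∈ FX X | X ^ (1 - δ) < |(discAB p.1 p.2 : ℝ)| ∧
    (sqPart (discAB p.1 p.2) : ℝ) ≤ 4 * X ^ δ}

theorem exists_card_divisors_le_rpow {ε : ℝ} (hε : 0 < ε) :
    ∃ C : ℝ, 0 < C ∧ ∀ n : ℕ, n ≠ 0 → (n.divisors.card : ℝ) ≤ C * (n : ℝ) ^ ε := by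
  have hl2 : 0 < Real.log 2 := Real.log_pos (by norm_num)
  set M : ℝ := 1 + 1 / (ε * Real.log 2) with hM
  have hM1 : 1 ≤ M := by rw [hM]; have : 0 ≤ 1 / (ε * Real.log 2) := by positivity
                         linarith
  set P : ℕ := ⌈(2 : ℝ) ^ (1 / ε)⌉₊ with hP
  have local_bound : ∀ p e : ℕ, p.Prime →
      (e : ℝ) + 1 ≤ (if p < P then M else 1) * ((p : ℝ) ^ e) ^ ε := by
    intro p e hp
    have hp2 : (2 : ℝ) ≤ p := by exact_mod_cast hp.two_le
    rw [← Real.rpow_natCast, ← Real.rpow_mul (by positivity)]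
    split_ifs with h
    · have h1 : (2 : ℝ) ^ ((e : ℝ) * ε) ≤ (p : ℝ) ^ ((e : ℝ) * ε) :=
        Real.rpow_le_rpow (by norm_num) hp2 (by positivity)
      have h2 : 1 + (e : ℝ) * ε * Real.log 2 ≤ (2 : ℝ) ^ ((e : ℝ) * ε) := by
        rw [Real.rpow_def_of_pos (by norm_num)]
        have := Real.add_one_le_exp (Real.log 2 * ((e : ℝ) * ε))
        linarith
      have h3 : (e : ℝ) + 1 ≤ M * (1 + (e : ℝ) * ε * Real.log 2) := by
        have : M * (1 + (e : ℝ) * ε * Real.log 2) =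
            1 + 1 / (ε * Real.log 2) + e * ε * Real.log 2 + e := by
          rw [hM]; field_simp; ring
        rw [this]
        have : 0 ≤ 1 / (ε * Real.log 2) + e * ε * Real.log 2 := by positivity
        linarith
      exact h3.trans (mul_le_mul_of_nonneg_left (h2.trans h1) (by linarith))
    · have h1 : (2 : ℝ) ^ (1 / ε) ≤ p :=
        (Nat.le_ceil _).trans (by exact_mod_cast not_lt.mp h)
      have h2 : (2 : ℝ) ≤ (p : ℝ) ^ ε := by
        have := Real.rpow_le_rpow (by positivity) h1 hε.le
        rwa [← Real.rpow_mul (by norm_num), one_div_mul_cancel hε.ne', Real.rpow_one] at this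
      rw [one_mul, mul_comm, Real.rpow_mul (by positivity), Real.rpow_natCast]
      have h3 : (2 : ℝ) ^ e ≤ ((p : ℝ) ^ ε) ^ e := pow_le_pow_left₀ (by norm_num) h2 e
      have h4 : (e : ℝ) + 1 ≤ 2 ^ e := by exact_mod_cast Nat.lt_two_pow_self (n := e)
      linarith
  refine ⟨M ^ P, by positivity, fun n hn => ?_⟩
  rw [Nat.card_divisors hn]
  push_cast
  calc ∏ p ∈ n.primeFactors, ((n.factorization p : ℝ) + 1)
      ≤ ∏ p ∈ n.primeFactors, ((if p < P then M else 1) *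
          ((p : ℝ) ^ n.factorization p) ^ ε) :=
        Finset.prod_le_prod (fun _ _ => by positivity)
          (fun p hp => local_bound p _ (Nat.prime_of_mem_primeFactors hp))
    _ = M ^ (n.primeFactors.filter (· < P)).card * (n : ℝ) ^ ε := by
        rw [Finset.prod_mul_distrib, ← Finset.prod_filter, Finset.prod_const,
          Real.finsetProd_rpow _ _ (fun _ _ => by positivity)]
        congr 2
        have := Nat.prod_factorization_pow_eq_self hn
        conv_rhs => rw [← this]
        simp [Finsupp.prod]
    _ ≤ M ^ P * (n : ℝ) ^ ε := by
        gcongr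
        calc _ ≤ (Finset.range P).card := Finset.card_le_card (fun p hp => by
              simp only [Finset.mem_filter] at hp; simpa using hp.2)
          _ = P := Finset.card_range P

/-- A finite set whose image under `f` is `c`-separated inside `[0, R]` is small. -/
theorem Finset.card_le_of_separated {α : Type*} (T : Finset α) (f : α → ℝ) {R c : ℝ} (hR : 0 ≤ R)
    (hc : 0 < c) (h0 : ∀ x ∈ T, 0 ≤ f x) (h1 : ∀ x ∈ T, f x ≤ R)
    (hsep : ∀ x ∈ T, ∀ y ∈ T, x ≠ y → c ≤ |f x - f y|) : (T.card : ℝ) ≤ R / c + 1 := by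
  have key : T.card ≤ (Finset.range (⌊R / c⌋₊ + 1)).card := by
    refine Finset.card_le_card_of_injOn (fun x => ⌊f x / c⌋₊) (fun x hx => ?_) ?_
    · have : ⌊f x / c⌋₊ ≤ ⌊R / c⌋₊ :=
        Nat.floor_le_floor (div_le_div_of_nonneg_right (h1 x hx) hc.le)
      simpa using Nat.lt_succ_of_le this
    · intro x hx y hy hxy
      by_contra hne
      have hs := hsep x hx y hy hne
      simp only at hxy
      have hx0 : 0 ≤ f x / c := div_nonneg (h0 x hx) hc.le
      have hy0 : 0 ≤ f y / c := div_nonneg (h0 y hy) hc.le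
      have a1 := Nat.floor_le hx0
      have a2 := Nat.lt_floor_add_one (f x / c)
      have b1 := Nat.floor_le hy0
      have b2 := Nat.lt_floor_add_one (f y / c)
      rw [hxy] at a1 a2
      have : |f x / c - f y / c| < 1 := by rw [abs_lt]; constructor <;> linarith
      rw [← sub_div, abs_div, abs_of_pos hc, div_lt_one hc] at this
      linarith
  have h2 : (T.card : ℝ) ≤ (⌊R / c⌋₊ : ℝ) + 1 := by
    rw [Finset.card_range] at key; exact_mod_cast key
  have := Nat.floor_le (div_nonneg hR hc.le)
  linarith

theorem exists_sq_mul_sqPart (n : ℕ) (hn : n ≠ 0) : ∃ m : ℕ, Squarefree m ∧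
    n = m * (n.factorization.prod fun p e => p ^ (e / 2)) ^ 2 := by
  obtain ⟨a, b, hab, ha⟩ := Nat.sq_mul_squarefree n
  have ha0 : a ≠ 0 := ha.ne_zero
  have hb0 : b ≠ 0 := by rintro rfl; simp at hab; exact hn hab.symm
  have hfac : ∀ p, n.factorization p / 2 = b.factorization p := by
    intro p
    have h1 := (Nat.squarefree_iff_factorization_le_one ha0).mp ha p
    rw [← hab, Nat.factorization_mul (by positivity) ha0, Nat.factorization_pow]
    simp only [Finsupp.coe_add, Finsupp.coe_smul, Pi.add_apply, Pi.smul_apply, smul_eq_mul]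
    omega
  refine ⟨a, ha, ?_⟩
  have : (n.factorization.prod fun p e => p ^ (e / 2)) = b := by
    conv_rhs => rw [← Nat.prod_factorization_pow_eq_self hb0]
    rw [Finsupp.prod, Finset.prod_congr rfl (fun p _ => by rw [hfac p])]
    symm
    refine Finsupp.prod_of_support_subset _ (fun p hp => ?_) _ (by simp)
    simp only [Finsupp.mem_support_iff] at hp ⊢
    intro h0
    have := hfac p
    rw [h0] at this
    exact hp (by simpa using this.symm)
  rw [this, ← hab]; ring

theorem Nat.dvd_of_sq_dvd_sq_mul_squarefree {e k r : ℕ} (hr : Squarefree r)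
    (hk : k ≠ 0) (h : e ^ 2 ∣ k ^ 2 * r) : e ∣ k := by
  obtain ⟨g, e', k', hg, hco, rfl, rfl⟩ := Nat.exists_coprime' (m := e) (n := k)
    (Nat.gcd_pos_of_pos_right _ (Nat.pos_of_ne_zero hk))
  have h1 : e' ^ 2 ∣ k' ^ 2 * r := by
    have : g ^ 2 * e' ^ 2 ∣ g ^ 2 * (k' ^ 2 * r) := by convert h using 1 <;> ring
    exact Nat.dvd_of_mul_dvd_mul_left (by positivity) this
  have h2 : e' ^ 2 ∣ r := (hco.pow 2 2).dvd_of_dvd_mul_left h1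
  have h3 := hr e' (by rwa [← sq])
  rw [Nat.isUnit_iff] at h3
  simp [h3]

theorem Nat.dvd_six_of_sq_dvd {e m : ℕ} (hm : Squarefree m) (h : e ^ 2 ∣ 12 * m) : e ∣ 6 := by
  by_cases h3 : 3 ∣ m
  · obtain ⟨m', rfl⟩ := h3
    refine Nat.dvd_of_sq_dvd_sq_mul_squarefree (hm.squarefree_of_dvd (Dvd.intro_left 3 rfl))
      (by norm_num) (?_ : e ^ 2 ∣ 6 ^ 2 * m')
    convert h using 1; ring
  · have hs : Squarefree (3 * m) := by
      rw [Nat.squarefree_mul ((Nat.Prime.coprime_iff_not_dvd Nat.prime_three).2 h3)]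
      exact ⟨Nat.prime_three.prime.squarefree, hm⟩
    have : e ∣ 2 := Nat.dvd_of_sq_dvd_sq_mul_squarefree hs (by norm_num) (by convert h using 1; ring)
    exact this.trans (by norm_num)

theorem Int.exists_mul_eq_and_dvd {N u w : ℤ} (hN : N ≠ 0) (h : N ∣ u * w) :
    ∃ k : ℤ, N = (Int.gcd u N : ℤ) * k ∧ k ∣ w := by
  obtain ⟨k, hk⟩ := Int.gcd_dvd_right u N
  refine ⟨k, hk, ?_⟩
  have hd : (Int.gcd u N : ℤ) ≠ 0 := by
    intro h0; rw [h0, zero_mul] at hk; exact hN hk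
  have h1 : N ∣ (Int.gcd u N : ℤ) * w := by
    rw [Int.gcd_eq_gcd_ab, add_mul]
    refine dvd_add ?_ ?_
    · rw [mul_right_comm]; exact h.mul_right _
    · rw [mul_assoc]; exact dvd_mul_right _ _
  obtain ⟨c, hc⟩ := h1
  refine ⟨c, mul_left_cancel₀ hd ?_⟩
  rw [hc]; conv_lhs => rw [hk]
  ring

theorem Int.mul_dvd_mul_of_gcd_dvd {d k c z : ℤ} (hd : d ∣ z) (hk : k ∣ z)
    (hc : (Int.gcd d k : ℤ) ∣ c) : d * k ∣ c * z := by
  have h1 : d * k ∣ (Int.gcd d k : ℤ) * z := by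
    rw [Int.gcd_eq_gcd_ab, add_mul]
    refine dvd_add ?_ ?_
    · rw [mul_assoc]; exact mul_dvd_mul_left _ (hk.mul_left _)
    · rw [mul_comm d k, mul_assoc]; exact mul_dvd_mul_left _ (hd.mul_left _)
  exact h1.trans (mul_dvd_mul_right hc z)

/-- Two primitive solutions of `x² - 3m y² = N` lying in the same class with respect to a third. -/
theorem Int.dvd_six_mul_cross {m : ℕ} {n N x₀ y₀ x₁ y₁ x₂ y₂ : ℤ} (hm : Squarefree m)
    (hn : n.natAbs = 3 * m) (hN : N ≠ 0)
    (h₀ : x₀ ^ 2 - n * y₀ ^ 2 = N) (h₁ : x₁ ^ 2 - n * y₁ ^ 2 = N) (h₂ : x₂ ^ 2 - n * y₂ ^ 2 = N)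
    (c₀ : IsCoprime y₀ N) (c₁ : IsCoprime y₁ N)
    (hd : Int.gcd (x₁ * y₀ - x₀ * y₁) N = Int.gcd (x₂ * y₀ - x₀ * y₂) N) :
    N ∣ 6 * (x₁ * y₂ - x₂ * y₁) := by
  have e₁ : N ∣ (x₁ * y₀ - x₀ * y₁) * (x₁ * y₀ + x₀ * y₁) :=
    ⟨y₀ ^ 2 - y₁ ^ 2, by linear_combination y₀ ^ 2 * h₁ - y₁ ^ 2 * h₀⟩
  have e₂ : N ∣ (x₂ * y₀ - x₀ * y₂) * (x₂ * y₀ + x₀ * y₂) :=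
    ⟨y₀ ^ 2 - y₂ ^ 2, by linear_combination y₀ ^ 2 * h₂ - y₂ ^ 2 * h₀⟩
  obtain ⟨k, hk, hkw⟩ := Int.exists_mul_eq_and_dvd hN e₁
  obtain ⟨k', hk', hkw'⟩ := Int.exists_mul_eq_and_dvd hN e₂
  have d1 := Int.gcd_dvd_left (x₁ * y₀ - x₀ * y₁) N
  have d2 := Int.gcd_dvd_left (x₂ * y₀ - x₀ * y₂) N
  rw [← hd] at hk' d2
  set d : ℤ := (Int.gcd (x₁ * y₀ - x₀ * y₁) N : ℤ) with hddef
  have hd0 : d ≠ 0 := by intro h; rw [h, zero_mul] at hk; exact hN hk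
  have hkk : k' = k := mul_left_cancel₀ hd0 (hk'.symm.trans hk)
  subst hkk
  have cd : IsCoprime d y₀ := (c₀.of_isCoprime_of_dvd_right ⟨k', hk⟩).symm
  have ck : IsCoprime k' y₀ := (c₀.of_isCoprime_of_dvd_right ⟨d, by rw [hk]; ring⟩).symm
  have z1 : d ∣ x₁ * y₂ - x₂ * y₁ := by
    refine cd.dvd_of_dvd_mul_left (?_ : d ∣ y₀ * _)
    have e : y₀ * (x₁ * y₂ - x₂ * y₁) =
        (x₁ * y₀ - x₀ * y₁) * y₂ - (x₂ * y₀ - x₀ * y₂) * y₁ := by ring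
    rw [e]
    exact dvd_sub (d1.mul_right y₂) (d2.mul_right y₁)
  have z2 : k' ∣ x₁ * y₂ - x₂ * y₁ := by
    refine ck.dvd_of_dvd_mul_left (?_ : k' ∣ y₀ * _)
    have e : y₀ * (x₁ * y₂ - x₂ * y₁) =
        (x₁ * y₀ + x₀ * y₁) * y₂ - (x₂ * y₀ + x₀ * y₂) * y₁ := by ring
    rw [e]
    exact dvd_sub (hkw.mul_right y₂) (hkw'.mul_right y₁)
  have he : (Int.gcd d k' : ℤ) ∣ 6 := by
    have g1 := Int.gcd_dvd_left d k'
    have g2 := Int.gcd_dvd_right d k'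
    set e : ℤ := (Int.gcd d k' : ℤ) with hedef
    have hee : e ^ 2 ∣ N := by rw [hk, sq]; exact mul_dvd_mul g1 g2
    have ce : IsCoprime e y₀ := cd.of_isCoprime_of_dvd_left g1
    have ce₁ : IsCoprime e y₁ :=
      (c₁.of_isCoprime_of_dvd_right ((dvd_pow_self e two_ne_zero).trans hee)).symm
    have f1 : e ∣ 2 * x₁ := by
      refine ce.dvd_of_dvd_mul_right (?_ : e ∣ 2 * x₁ * y₀)
      have h : 2 * x₁ * y₀ = (x₁ * y₀ - x₀ * y₁) + (x₁ * y₀ + x₀ * y₁) := by ring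
      rw [h]
      exact dvd_add (g1.trans d1) (g2.trans hkw)
    have f2 : e ^ 2 ∣ 4 * n * y₁ ^ 2 := by
      have h : 4 * n * y₁ ^ 2 = (2 * x₁) ^ 2 - 4 * N := by linear_combination -4 * h₁
      rw [h]
      exact dvd_sub (pow_dvd_pow_of_dvd f1 2) (hee.mul_left 4)
    have f3 : e ^ 2 ∣ 4 * n := (ce₁.pow (m := 2) (n := 2)).dvd_of_dvd_mul_right f2
    have f4 : e.natAbs ^ 2 ∣ 12 * m := by
      have := Int.natAbs_dvd_natAbs.mpr f3
      rw [Int.natAbs_pow, Int.natAbs_mul, hn, ← mul_assoc] at this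
      exact this
    exact Int.natAbs_dvd_natAbs.mp (Nat.dvd_six_of_sq_dvd hm f4)
  rw [hk]
  exact Int.mul_dvd_mul_of_gcd_dvd z1 z2 he

theorem Int.isCoprime_of_sq_sub_mul_sq {n N : ℤ} {x y : ℕ} (h : (x : ℤ) ^ 2 - n * (y : ℤ) ^ 2 = N)
    (hxy : Nat.Coprime x y) : IsCoprime (y : ℤ) N := by
  have h1 : IsCoprime (y : ℤ) ((x : ℤ) ^ 2) :=
    ((Nat.isCoprime_iff_coprime.mpr hxy).symm).pow_right
  have : N = (x : ℤ) ^ 2 + y * (-n * y) := by rw [← h]; ring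
  rw [this]
  exact h1.add_mul_left_right _

theorem Nat.Coprime.eq_of_mul_eq_mul {x₁ y₁ x₂ y₂ : ℕ} (h₁ : Nat.Coprime x₁ y₁)
    (h₂ : Nat.Coprime x₂ y₂) (h : x₁ * y₂ = x₂ * y₁) : x₁ = x₂ ∧ y₁ = y₂ :=
  ⟨Nat.dvd_antisymm (h₁.dvd_of_dvd_mul_right (Dvd.intro _ h))
    (h₂.dvd_of_dvd_mul_right (Dvd.intro _ h.symm)),
   Nat.dvd_antisymm (h₁.symm.dvd_of_dvd_mul_left (Dvd.intro_left _ h.symm |>.trans (by rw [mul_comm])))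
    (h₂.symm.dvd_of_dvd_mul_left (Dvd.intro_left _ h))⟩

/-- In the indefinite case, inequivalent solutions are separated logarithmically. -/
theorem log_separated_of_cross {s N x₁ y₁ x₂ y₂ : ℝ} (hs : 1 ≤ s) (hx₁ : 0 ≤ x₁) (hy₁ : 0 ≤ y₁)
    (hx₂ : 0 ≤ x₂) (hy₂ : 0 ≤ y₂) (hN : N ≠ 0)
    (h₁ : x₁ ^ 2 - s ^ 2 * y₁ ^ 2 = N) (h₂ : x₂ ^ 2 - s ^ 2 * y₂ ^ 2 = N)
    (hc : |N| ≤ 6 * |x₁ * y₂ - x₂ * y₁|) :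
    1 / 7 ≤ |Real.log (x₁ + s * y₁) - Real.log (x₂ + s * y₂)| := by
  have pos : ∀ x y : ℝ, 0 ≤ x → 0 ≤ y → x ^ 2 - s ^ 2 * y ^ 2 = N → 0 < x + s * y := by
    intro x y hx hy h
    have h0 : 0 ≤ x + s * y := by positivity
    rcases h0.lt_or_eq with h0 | h0
    · exact h0
    · exfalso; apply hN
      rw [← h]; linear_combination -(x - s * y) * h0
  wlog hle : x₂ + s * y₂ ≤ x₁ + s * y₁ generalizing x₁ x₂ y₁ y₂
  · rw [abs_sub_comm]
    exact this hx₂ hy₂ hx₁ hy₁ h₂ h₁ (by rw [abs_sub_comm]; exact hc) (not_le.mp hle).le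
  have p₁ := pos x₁ y₁ hx₁ hy₁ h₁
  have p₂ := pos x₂ y₂ hx₂ hy₂ h₂
  set t₁ := x₁ + s * y₁ with ht₁
  set t₂ := x₂ + s * y₂ with ht₂
  have key : N * (t₁ ^ 2 - t₂ ^ 2) = -(2 * s * (x₁ * y₂ - x₂ * y₁)) * (t₁ * t₂) := by
    have a : N = t₁ * (x₁ - s * y₁) := by rw [← h₁]; ring
    have b : N = t₂ * (x₂ - s * y₂) := by rw [← h₂]; ring
    rw [mul_sub]
    nth_rewrite 1 [b]
    nth_rewrite 1 [a]
    rw [ht₁, ht₂]; ring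
  have habs : |N| * (t₁ ^ 2 - t₂ ^ 2) = 2 * s * |x₁ * y₂ - x₂ * y₁| * (t₁ * t₂) := by
    have h := congrArg abs key
    rw [abs_mul, abs_mul, abs_neg, abs_mul, abs_of_nonneg (by nlinarith : 0 ≤ t₁ ^ 2 - t₂ ^ 2),
      abs_of_pos (by positivity : 0 < t₁ * t₂), abs_of_pos (by positivity : 0 < 2 * s)] at h
    exact h
  have hN' : 0 < |N| := abs_pos.mpr hN
  have h3 : t₁ * t₂ ≤ 3 * (t₁ ^ 2 - t₂ ^ 2) := by
    have : |N| * (t₁ * t₂) ≤ |N| * (3 * (t₁ ^ 2 - t₂ ^ 2)) := by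
      calc |N| * (t₁ * t₂) ≤ (6 * |x₁ * y₂ - x₂ * y₁|) * (t₁ * t₂) := by gcongr
        _ = 3 * (2 * 1 * |x₁ * y₂ - x₂ * y₁| * (t₁ * t₂)) := by ring
        _ ≤ 3 * (2 * s * |x₁ * y₂ - x₂ * y₁| * (t₁ * t₂)) := by gcongr
        _ = _ := by rw [← habs]; ring
    exact le_of_mul_le_mul_left this hN'
  have h4 : 7 / 6 * t₂ ≤ t₁ := by
    by_contra! hlt
    nlinarith
  have h5 : 1 / 7 ≤ Real.log t₁ - Real.log t₂ := by
    rw [← Real.log_div p₁.ne' p₂.ne']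
    have h6 : 7 / 6 ≤ t₁ / t₂ := by rw [le_div_iff₀ p₂]; exact h4
    have h7 := Real.one_sub_inv_le_log_of_pos (by norm_num : (0 : ℝ) < 7 / 6)
    have h8 := Real.log_le_log (by norm_num) h6
    norm_num at h7
    linarith
  exact h5.trans (le_abs_self _)

/-- In the definite case, inequivalent solutions are separated on the ellipse. -/
theorem separated_of_cross {s N x₁ y₁ x₂ y₂ : ℝ} (hs : 1 ≤ s) (hx₁ : 0 ≤ x₁) (hy₁ : 0 ≤ y₁)
    (hx₂ : 0 ≤ x₂) (hy₂ : 0 ≤ y₂) (hN : 0 < N)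
    (h₁ : x₁ ^ 2 + s ^ 2 * y₁ ^ 2 = N) (h₂ : x₂ ^ 2 + s ^ 2 * y₂ ^ 2 = N)
    (hc : |N| ≤ 6 * |x₁ * y₂ - x₂ * y₁|) :
    √N / 6 ≤ |(√N + s * y₁ - x₁) - (√N + s * y₂ - x₂)| := by
  have hr : 0 < √N := Real.sqrt_pos.mpr hN
  have hrr : √N * √N = N := Real.mul_self_sqrt hN.le
  wlog hle : y₁ ≤ y₂ generalizing x₁ x₂ y₁ y₂
  · rw [abs_sub_comm]
    exact this hx₂ hy₂ hx₁ hy₁ h₂ h₁ (by rw [abs_sub_comm]; exact hc) (not_le.mp hle).le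
  have hx : x₂ ≤ x₁ := by
    have h : s ^ 2 * y₁ ^ 2 ≤ s ^ 2 * y₂ ^ 2 := by gcongr
    exact (sq_le_sq₀ hx₂ hx₁).mp (by linarith)
  have hx1 : x₁ ≤ √N := Real.le_sqrt_of_sq_le (by nlinarith [sq_nonneg (s * y₁)])
  have hy1 : s * y₁ ≤ √N := Real.le_sqrt_of_sq_le (by nlinarith [sq_nonneg x₁])
  have hcr : 0 ≤ x₁ * y₂ - x₂ * y₁ := by nlinarith
  rw [abs_of_pos hN, abs_of_nonneg hcr] at hc
  have h0 : (√N + s * y₁ - x₁) - (√N + s * y₂ - x₂) = -(s * (y₂ - y₁) + (x₁ - x₂)) := by ring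
  have hnn : 0 ≤ s * (y₂ - y₁) := mul_nonneg (by linarith) (by linarith)
  rw [h0, abs_neg, abs_of_nonneg (by linarith)]
  have h5 : s * (x₁ * y₂ - x₂ * y₁) ≤ √N * (s * (y₂ - y₁) + (x₁ - x₂)) := by
    have e : s * (x₁ * y₂ - x₂ * y₁) = x₁ * (s * (y₂ - y₁)) + (s * y₁) * (x₁ - x₂) := by ring
    rw [e, mul_add]
    gcongr
  have h6 : x₁ * y₂ - x₂ * y₁ ≤ s * (x₁ * y₂ - x₂ * y₁) := le_mul_of_one_le_left hcr hs
  have h7 : √N * (√N / 6) ≤ √N * (s * (y₂ - y₁) + (x₁ - x₂)) := by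
    have : √N * (√N / 6) = N / 6 := by rw [← hrr]; ring_nf; simp
    linarith
  exact le_of_mul_le_mul_left h7 hr

theorem card_le_of_cross {n N : ℤ} (hn : n ≠ 0) (hN : N ≠ 0) {Z : ℕ} (hZ : 1 ≤ Z)
    (T : Finset (ℕ × ℕ))
    (hT : ∀ q ∈ T, (q.1 : ℤ) ^ 2 - n * (q.2 : ℤ) ^ 2 = N)
    (hTZ : ∀ q ∈ T, q.1 ≤ Z ∧ q.2 ≤ Z) (hco : ∀ q ∈ T, Nat.Coprime q.1 q.2)
    (hcross : ∀ q ∈ T, ∀ r ∈ T, N ∣ 6 * ((q.1 : ℤ) * r.2 - r.1 * q.2)) :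
    (T.card : ℝ) ≤ 7 * Real.log (Z * (1 + √|(n : ℝ)|)) + 13 := by
  set s : ℝ := √|(n : ℝ)| with hsdef
  have hn1 : (1 : ℝ) ≤ |(n : ℝ)| := by
    have := Int.one_le_abs hn
    exact_mod_cast this
  have hs : 1 ≤ s := Real.one_le_sqrt.mpr hn1
  have hs2 : s ^ 2 = |(n : ℝ)| := Real.sq_sqrt (abs_nonneg _)
  have hZ' : (1 : ℝ) ≤ Z := by exact_mod_cast hZ
  have hlog : 0 ≤ Real.log (Z * (1 + s)) := Real.log_nonneg (by nlinarith)
  have hTr : ∀ q ∈ T, (q.1 : ℝ) ^ 2 - n * (q.2 : ℝ) ^ 2 = N := fun q hq => by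
    exact_mod_cast hT q hq
  have hN' : (N : ℝ) ≠ 0 := by exact_mod_cast hN
  have hc : ∀ q ∈ T, ∀ r ∈ T, q ≠ r →
      |(N : ℝ)| ≤ 6 * |(q.1 : ℝ) * r.2 - r.1 * q.2| := by
    intro q hq r hr hne
    have h0 : (q.1 : ℤ) * r.2 - r.1 * q.2 ≠ 0 := by
      intro h
      have h' : q.1 * r.2 = r.1 * q.2 := by exact_mod_cast sub_eq_zero.mp h
      obtain ⟨h1, h2⟩ := Nat.Coprime.eq_of_mul_eq_mul (hco q hq) (hco r hr) h'
      exact hne (Prod.ext h1 h2)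
    have h1 := Int.le_of_dvd (abs_pos.mpr (mul_ne_zero (by norm_num) h0))
      ((abs_dvd _ _).mpr ((dvd_abs _ _).mpr (hcross q hq r hr)))
    rw [abs_mul] at h1
    have h2 : ((|N| : ℤ) : ℝ) ≤ ((|6| * |(q.1 : ℤ) * r.2 - r.1 * q.2| : ℤ) : ℝ) := by
      exact_mod_cast h1
    push_cast at h2
    simpa using h2
  rcases lt_or_gt_of_ne hn with hneg | hpos
  · have hs2' : s ^ 2 = -(n : ℝ) := by
      rw [hs2, abs_of_neg (by exact_mod_cast hneg)]
    have hTr' : ∀ q ∈ T, (q.1 : ℝ) ^ 2 + s ^ 2 * (q.2 : ℝ) ^ 2 = N := fun q hq => by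
      rw [← hTr q hq, hs2']; ring
    rcases T.eq_empty_or_nonempty with rfl | ⟨q₀, hq₀⟩
    · simp; linarith
    have hNpos : (0 : ℝ) < N := lt_of_le_of_ne (by rw [← hTr' q₀ hq₀]; positivity) hN'.symm
    have hr : 0 < √(N : ℝ) := Real.sqrt_pos.mpr hNpos
    have := Finset.card_le_of_separated T (fun q => √(N : ℝ) + s * (q.2 : ℝ) - q.1)
      (R := 2 * √(N : ℝ)) (c := √(N : ℝ) / 6) (by positivity) (by positivity)
      (fun q hq => by
        have : (q.1 : ℝ) ≤ √(N : ℝ) := Real.le_sqrt_of_sq_le (by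
          rw [← hTr' q hq]; exact le_add_of_nonneg_right (by positivity))
        have h2 : 0 ≤ s * (q.2 : ℝ) := by positivity
        linarith)
      (fun q hq => by
        have : s * (q.2 : ℝ) ≤ √(N : ℝ) := Real.le_sqrt_of_sq_le (by
          rw [← hTr' q hq, mul_pow]; exact le_add_of_nonneg_left (by positivity))
        have h2 : (0 : ℝ) ≤ q.1 := by positivity
        linarith)
      (fun q hq r hr hne => separated_of_cross hs (by positivity) (by positivity) (by positivity)
        (by positivity) hNpos (hTr' q hq) (hTr' r hr) (hc q hq r hr hne))
    have e : 2 * √(N : ℝ) / (√(N : ℝ) / 6) + 1 = 13 := by field_simp; norm_num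
    linarith
  · have hs2' : s ^ 2 = (n : ℝ) := by
      rw [hs2, abs_of_pos (by exact_mod_cast hpos)]
    have h1 : ∀ q ∈ T, (1 : ℝ) ≤ q.1 + s * (q.2 : ℝ) := by
      intro q hq
      have h : 1 ≤ q.1 + q.2 := by
        by_contra! h
        have h01 : q.1 = 0 := by omega
        have h02 : q.2 = 0 := by omega
        have := hco q hq
        rw [h01, h02] at this
        simp at this
      have h' : (1 : ℝ) ≤ q.1 + q.2 := by exact_mod_cast h
      have : (q.2 : ℝ) ≤ s * q.2 := le_mul_of_one_le_left (by positivity) hs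
      linarith
    have := Finset.card_le_of_separated T (fun q => Real.log (q.1 + s * (q.2 : ℝ)))
      (R := Real.log (Z * (1 + s))) (c := 1 / 7) hlog (by norm_num)
      (fun q hq => Real.log_nonneg (h1 q hq))
      (fun q hq => Real.log_le_log (by linarith [h1 q hq]) (by
        have a : (q.1 : ℝ) ≤ Z := by exact_mod_cast (hTZ q hq).1
        have b : (q.2 : ℝ) ≤ Z := by exact_mod_cast (hTZ q hq).2
        nlinarith))
      (fun q hq r hr hne => log_separated_of_cross hs (by positivity) (by positivity)
        (by positivity) (by positivity) hN' (by rw [hs2']; exact hTr q hq)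
        (by rw [hs2']; exact hTr r hr) (hc q hq r hr hne))
    have e : Real.log (Z * (1 + s)) / (1 / 7) + 1 = 7 * Real.log (Z * (1 + s)) + 1 := by ring
    linarith

/-- If all fibres of `f` have real size at most `K` then so does the average. -/
theorem Finset.card_le_card_mul_of_fibers {α β : Type*} [DecidableEq β] (T : Finset α)
    (D : Finset β) (f : α → β) {K : ℝ} (hf : ∀ x ∈ T, f x ∈ D)
    (hK : ∀ d ∈ D, ((T.filter (fun x => f x = d)).card : ℝ) ≤ K) :
    (T.card : ℝ) ≤ D.card * K := by
  rw [Finset.card_eq_sum_card_fiberwise hf]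
  push_cast
  calc _ ≤ ∑ _d ∈ D, K := Finset.sum_le_sum hK
    _ = _ := by rw [Finset.sum_const, nsmul_eq_mul]

theorem card_primitive_solutions_le {m : ℕ} {n N : ℤ} (hm : Squarefree m)
    (hn : n.natAbs = 3 * m) (hN : N ≠ 0) {Z : ℕ} (hZ : 1 ≤ Z) (T : Finset (ℕ × ℕ))
    (hT : ∀ q ∈ T, (q.1 : ℤ) ^ 2 - n * (q.2 : ℤ) ^ 2 = N)
    (hTZ : ∀ q ∈ T, q.1 ≤ Z ∧ q.2 ≤ Z) (hco : ∀ q ∈ T, Nat.Coprime q.1 q.2) :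
    (T.card : ℝ) ≤ N.natAbs.divisors.card * (7 * Real.log (Z * (1 + √|(n : ℝ)|)) + 13) := by
  have hn0 : n ≠ 0 := by
    rintro rfl
    have := hm.ne_zero
    simp at hn; omega
  rcases T.eq_empty_or_nonempty with rfl | ⟨q₀, hq₀⟩
  · have hZ' : (1 : ℝ) ≤ Z := by exact_mod_cast hZ
    have : 0 ≤ Real.log (Z * (1 + √|(n : ℝ)|)) :=
      Real.log_nonneg (by nlinarith [Real.sqrt_nonneg |(n : ℝ)|])
    simp only [Finset.card_empty, Nat.cast_zero]
    positivity
  have cop : ∀ q ∈ T, IsCoprime (q.2 : ℤ) N := fun q hq =>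
    Int.isCoprime_of_sq_sub_mul_sq (hT q hq) (hco q hq)
  refine Finset.card_le_card_mul_of_fibers T _
    (fun q => Int.gcd ((q.1 : ℤ) * q₀.2 - q₀.1 * q.2) N) (fun q _ => ?_) (fun d _ => ?_)
  · rw [Nat.mem_divisors]
    exact ⟨Int.gcd_dvd_natAbs_right _ _, by simpa using hN⟩
  · refine card_le_of_cross hn0 hN hZ _ (fun q hq => hT q (Finset.mem_filter.mp hq).1)
      (fun q hq => hTZ q (Finset.mem_filter.mp hq).1)
      (fun q hq => hco q (Finset.mem_filter.mp hq).1) (fun q hq r hr => ?_)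
    rw [Finset.mem_filter] at hq hr
    exact Int.dvd_six_mul_cross hm hn hN (hT q₀ hq₀) (hT q hq.1) (hT r hr.1) (cop q₀ hq₀)
      (cop q hq.1) (hq.2.trans hr.2.symm)

theorem card_solutions_le {m : ℕ} {n N : ℤ} (hm : Squarefree m)
    (hn : n.natAbs = 3 * m) (hN : N ≠ 0) {Z : ℕ} (hZ : 1 ≤ Z) (T : Finset (ℕ × ℕ))
    (hT : ∀ q ∈ T, (q.1 : ℤ) ^ 2 - n * (q.2 : ℤ) ^ 2 = N)
    (hTZ : ∀ q ∈ T, q.1 ≤ Z ∧ q.2 ≤ Z) :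
    (T.card : ℝ) ≤ N.natAbs.divisors.card *
      (N.natAbs.divisors.card * (7 * Real.log (Z * (1 + √|(n : ℝ)|)) + 13)) := by
  have hNn : N.natAbs ≠ 0 := by simpa using hN
  have hZ' : (1 : ℝ) ≤ Z := by exact_mod_cast hZ
  have hlog : 0 ≤ Real.log (Z * (1 + √|(n : ℝ)|)) :=
    Real.log_nonneg (by nlinarith [Real.sqrt_nonneg |(n : ℝ)|])
  refine Finset.card_le_card_mul_of_fibers T _ (fun q => Nat.gcd q.1 q.2) (fun q hq => ?_)
    (fun g hg => ?_)
  · rw [Nat.mem_divisors]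
    refine ⟨?_, hNn⟩
    have h1 : (Nat.gcd q.1 q.2 : ℤ) ∣ N := by
      rw [← hT q hq, sq, sq]
      exact dvd_sub ((Int.natCast_dvd_natCast.mpr (Nat.gcd_dvd_left _ _)).mul_right _)
        (((Int.natCast_dvd_natCast.mpr (Nat.gcd_dvd_right _ _)).mul_right _).mul_left _)
    exact Int.natCast_dvd.mp h1
  · set T' := T.filter (fun q => Nat.gcd q.1 q.2 = g) with hT'
    have hg0 : 0 < g := Nat.pos_of_mem_divisors hg
    have hgz : (g : ℤ) ≠ 0 := by exact_mod_cast hg0.ne'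
    rcases T'.eq_empty_or_nonempty with h | ⟨q₀, hq₀⟩
    · rw [h]; simp only [Finset.card_empty, Nat.cast_zero]; positivity
    have rep : ∀ q ∈ T', q.1 = g * (q.1 / g) ∧ q.2 = g * (q.2 / g) := by
      intro q hq
      have hq2 := (Finset.mem_filter.mp hq).2
      exact ⟨(Nat.mul_div_cancel' (hq2 ▸ Nat.gcd_dvd_left _ _)).symm,
        (Nat.mul_div_cancel' (hq2 ▸ Nat.gcd_dvd_right _ _)).symm⟩
    have eqn : ∀ q ∈ T', (g : ℤ) ^ 2 *
        (((q.1 / g : ℕ) : ℤ) ^ 2 - n * ((q.2 / g : ℕ) : ℤ) ^ 2) = N := by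
      intro q hq
      have h := hT q (Finset.mem_filter.mp hq).1
      rw [(rep q hq).1, (rep q hq).2] at h
      rw [← h]; push_cast; ring
    set N' : ℤ := ((q₀.1 / g : ℕ) : ℤ) ^ 2 - n * ((q₀.2 / g : ℕ) : ℤ) ^ 2 with hN'
    have hNN' : (g : ℤ) ^ 2 * N' = N := eqn q₀ hq₀
    have hN'0 : N' ≠ 0 := by rintro h; rw [h, mul_zero] at hNN'; exact hN hNN'.symm
    have hcard : (T'.image (fun q => (q.1 / g, q.2 / g))).card = T'.card := by
      refine Finset.card_image_of_injOn (fun q hq r hr h => ?_)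
      have h1 := rep q hq
      have h2 := rep r hr
      simp only [Prod.mk.injEq] at h
      rw [h.1] at h1
      rw [h.2] at h1
      exact Prod.ext (h1.1.trans h2.1.symm) (h1.2.trans h2.2.symm)
    have hp := card_primitive_solutions_le hm hn hN'0 hZ
      (T'.image (fun q => (q.1 / g, q.2 / g)))
      (by
        simp only [Finset.forall_mem_image]
        intro q hq
        exact mul_left_cancel₀ (pow_ne_zero 2 hgz) ((eqn q hq).trans hNN'.symm))
      (by
        simp only [Finset.forall_mem_image]
        intro q hq
        have := hTZ q (Finset.mem_filter.mp hq).1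
        exact ⟨(Nat.div_le_self _ _).trans this.1, (Nat.div_le_self _ _).trans this.2⟩)
      (by
        simp only [Finset.forall_mem_image]
        intro q hq
        have hq2 := (Finset.mem_filter.mp hq).2
        have := Nat.coprime_div_gcd_div_gcd (m := q.1) (n := q.2) (by rw [hq2]; exact hg0)
        rwa [hq2] at this)
    rw [hcard] at hp
    refine hp.trans ?_
    gcongr
    exact Int.natAbs_dvd_natAbs.mpr ⟨(g : ℤ) ^ 2, by rw [← hNN']; ring⟩

theorem sq_dvd_mul_of_same_class {A B₀ B₁ B₂ : ℤ} {l : ℕ} (hl : l ≠ 0)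
    (h₀ : (l : ℤ) ^ 2 ∣ 4 * A ^ 3 + 27 * B₀ ^ 2) (h₁ : (l : ℤ) ^ 2 ∣ 4 * A ^ 3 + 27 * B₁ ^ 2)
    (h₂ : (l : ℤ) ^ 2 ∣ 4 * A ^ 3 + 27 * B₂ ^ 2)
    (hd : Int.gcd (27 * (B₁ - B₀)) ((l : ℤ) ^ 2) = Int.gcd (27 * (B₂ - B₀)) ((l : ℤ) ^ 2)) :
    (l : ℤ) ^ 2 ∣ (Nat.gcd l (432 * A ^ 3).natAbs : ℤ) * (27 * (B₁ - B₂)) := by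
  have hN : (l : ℤ) ^ 2 ≠ 0 := by positivity
  have e : ∀ B : ℤ, (l : ℤ) ^ 2 ∣ 4 * A ^ 3 + 27 * B ^ 2 →
      (l : ℤ) ^ 2 ∣ 27 * (B - B₀) * (B + B₀) := fun B h => by
    have h' : 27 * (B - B₀) * (B + B₀) =
      (4 * A ^ 3 + 27 * B ^ 2) - (4 * A ^ 3 + 27 * B₀ ^ 2) := by ring
    rw [h']; exact dvd_sub h h₀
  obtain ⟨k, hk, hkw⟩ := Int.exists_mul_eq_and_dvd hN (e B₁ h₁)
  obtain ⟨k', hk', hkw'⟩ := Int.exists_mul_eq_and_dvd hN (e B₂ h₂)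
  have d1 := Int.gcd_dvd_left (27 * (B₁ - B₀)) ((l : ℤ) ^ 2)
  have d2 := Int.gcd_dvd_left (27 * (B₂ - B₀)) ((l : ℤ) ^ 2)
  rw [← hd] at hk' d2
  set d : ℤ := (Int.gcd (27 * (B₁ - B₀)) ((l : ℤ) ^ 2) : ℤ) with hddef
  have hd0 : d ≠ 0 := by intro h; rw [h, zero_mul] at hk; exact hN hk
  have hkk : k' = k := mul_left_cancel₀ hd0 (hk'.symm.trans hk)
  subst hkk
  have z1 : d ∣ 27 * (B₁ - B₂) := by
    have h : 27 * (B₁ - B₂) = 27 * (B₁ - B₀) - 27 * (B₂ - B₀) := by ring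
    rw [h]; exact dvd_sub d1 d2
  have z2 : k' ∣ 27 * (B₁ - B₂) := by
    have h : 27 * (B₁ - B₂) = 27 * ((B₁ + B₀) - (B₂ + B₀)) := by ring
    rw [h]; exact (dvd_sub hkw hkw').mul_left _
  have g1 := Int.gcd_dvd_left d k'
  have g2 := Int.gcd_dvd_right d k'
  have he : (Int.gcd d k' : ℤ) ∣ (Nat.gcd l (432 * A ^ 3).natAbs : ℤ) := by
    have hee : (Int.gcd d k' : ℤ) ^ 2 ∣ (l : ℤ) ^ 2 := by
      rw [hk, sq]; exact mul_dvd_mul g1 g2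
    have f0 : Int.gcd d k' ∣ l := by
      have : (Int.gcd d k') ^ 2 ∣ l ^ 2 := by exact_mod_cast hee
      exact (Nat.pow_dvd_pow_iff two_ne_zero).mp this
    have f1 : (Int.gcd d k' : ℤ) ∣ 54 * B₀ := by
      have h : 54 * B₀ = 27 * (B₁ + B₀) - 27 * (B₁ - B₀) := by ring
      rw [h]; exact dvd_sub ((g2.trans hkw).mul_left _) (g1.trans d1)
    have f2 : (Int.gcd d k' : ℤ) ^ 2 ∣ 432 * A ^ 3 := by
      have h : 432 * A ^ 3 = 108 * (4 * A ^ 3 + 27 * B₀ ^ 2) - (54 * B₀) ^ 2 := by ring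
      rw [h]; exact dvd_sub ((hee.trans h₀).mul_left _) (pow_dvd_pow_of_dvd f1 2)
    exact Int.natCast_dvd_natCast.mpr
      (Nat.dvd_gcd f0 (Int.natCast_dvd.mp ((dvd_pow_self _ two_ne_zero).trans f2)))
  rw [hk]
  exact Int.mul_dvd_mul_of_gcd_dvd z1 z2 he

theorem card_roots_le (A : ℤ) {l : ℕ} (hl : l ≠ 0) (N : ℕ) (T : Finset ℤ)
    (hT : ∀ B ∈ T, |B| ≤ N) (hroot : ∀ B ∈ T, (l : ℤ) ^ 2 ∣ 4 * A ^ 3 + 27 * B ^ 2) :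
    (T.card : ℝ) ≤ (l ^ 2).divisors.card *
      (54 * N * (Nat.gcd l (432 * A ^ 3).natAbs / (l : ℝ) ^ 2) + 1) := by
  rcases T.eq_empty_or_nonempty with rfl | ⟨B₀, hB₀⟩
  · simp only [Finset.card_empty, Nat.cast_zero]; positivity
  set g := Nat.gcd l (432 * A ^ 3).natAbs with hg
  have hg0 : 0 < g := Nat.gcd_pos_of_pos_left _ (Nat.pos_of_ne_zero hl)
  refine Finset.card_le_card_mul_of_fibers T _
    (fun B => Int.gcd (27 * (B - B₀)) ((l : ℤ) ^ 2)) (fun B _ => ?_) (fun d _ => ?_)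
  · rw [Nat.mem_divisors]
    refine ⟨?_, by positivity⟩
    have := Int.gcd_dvd_natAbs_right (27 * (B - B₀)) ((l : ℤ) ^ 2)
    rwa [Int.natAbs_pow, Int.natAbs_natCast] at this
  · have hl' : (0 : ℝ) < l := by exact_mod_cast Nat.pos_of_ne_zero hl
    have hg' : (0 : ℝ) < g := by exact_mod_cast hg0
    have := Finset.card_le_of_separated
      (T.filter (fun B => Int.gcd (27 * (B - B₀)) ((l : ℤ) ^ 2) = d))
      (fun B => (B : ℝ) + N) (R := 2 * N) (c := (l : ℝ) ^ 2 / (27 * g)) (by positivity)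
      (by positivity)
      (fun B hB => by
        have h := hT B (Finset.mem_filter.mp hB).1
        have h' : (-(N : ℤ) : ℝ) ≤ B := by exact_mod_cast (abs_le.mp h).1
        push_cast at h'
        linarith)
      (fun B hB => by
        have h := hT B (Finset.mem_filter.mp hB).1
        have h' : (B : ℝ) ≤ N := by exact_mod_cast (abs_le.mp h).2
        linarith)
      (fun B hB B' hB' hne => by
        rw [Finset.mem_filter] at hB hB'
        have h := sq_dvd_mul_of_same_class hl (hroot B₀ hB₀) (hroot B hB.1) (hroot B' hB'.1)
          (hB.2.trans hB'.2.symm)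
        rw [← hg] at h
        have h0 : (g : ℤ) * (27 * (B - B')) ≠ 0 :=
          mul_ne_zero (by exact_mod_cast hg0.ne') (mul_ne_zero (by norm_num) (sub_ne_zero.mpr hne))
        have h1 := Int.le_of_dvd (abs_pos.mpr h0) ((dvd_abs _ _).mpr h)
        rw [abs_mul, abs_mul] at h1
        have h2 : (l : ℝ) ^ 2 ≤ |(g : ℝ)| * (|27| * |(B : ℝ) - B'|) := by exact_mod_cast h1
        rw [abs_of_pos hg', abs_of_pos (by norm_num : (0 : ℝ) < 27)] at h2
        rw [add_sub_add_right_eq_sub, div_le_iff₀ (by positivity)]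
        linarith)
    have e : 2 * (N : ℝ) / ((l : ℝ) ^ 2 / (27 * g)) = 54 * N * (g / (l : ℝ) ^ 2) := by
      field_simp; ring
    rwa [e] at this

theorem sum_inv_sq_le_of_lt (F : Finset ℕ) {y : ℝ} (hy : 0 < y) (hF : ∀ k ∈ F, y < k) :
    ∑ k ∈ F, ((k : ℝ) ^ 2)⁻¹ ≤ 2 / y := by
  have h1 : F ⊆ Finset.Ioo ⌊y⌋₊ (F.sup id + 1) := fun k hk => by
    rw [Finset.mem_Ioo]
    refine ⟨(Nat.floor_lt hy.le).mpr (hF k hk), Nat.lt_succ_of_le (Finset.le_sup (f := id) hk)⟩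
  calc ∑ k ∈ F, ((k : ℝ) ^ 2)⁻¹ ≤ ∑ k ∈ Finset.Ioo ⌊y⌋₊ (F.sup id + 1), ((k : ℝ) ^ 2)⁻¹ :=
        Finset.sum_le_sum_of_subset_of_nonneg h1 (fun _ _ _ => by positivity)
    _ ≤ 2 / (⌊y⌋₊ + 1) := sum_Ioo_inv_sq_le _ _
    _ ≤ 2 / y := by gcongr; exact (Nat.lt_floor_add_one y).le

theorem sum_gcd_div_sq_le (F : Finset ℕ) {y : ℝ} (hy : 0 < y) (hF : ∀ l ∈ F, y < l) {W : ℕ}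
    (hW : W ≠ 0) :
    ∑ l ∈ F, (Nat.gcd l W : ℝ) / (l : ℝ) ^ 2 ≤ W.divisors.card * (2 / y) := by
  rw [← Finset.sum_fiberwise_of_maps_to (t := W.divisors) (g := fun l => Nat.gcd l W)
    (fun l _ => Nat.mem_divisors.mpr ⟨Nat.gcd_dvd_right _ _, hW⟩)]
  calc _ ≤ ∑ _d ∈ W.divisors, 2 / y := Finset.sum_le_sum (fun g hg => ?_)
    _ = _ := by rw [Finset.sum_const, nsmul_eq_mul]
  have hg0 : 0 < g := Nat.pos_of_mem_divisors hg
  have hg' : (0 : ℝ) < g := by exact_mod_cast hg0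
  set F' := F.filter (fun l => Nat.gcd l W = g) with hF'
  have rep : ∀ l ∈ F', l = g * (l / g) := fun l hl =>
    (Nat.mul_div_cancel' ((Finset.mem_filter.mp hl).2 ▸ Nat.gcd_dvd_left _ _)).symm
  have inj : Set.InjOn (fun l => l / g) (F' : Set ℕ) := fun l hl l' hl' h => by
    simp only at h
    rw [rep l hl, rep l' hl', h]
  have h1 := sum_inv_sq_le_of_lt (F'.image (fun l => l / g)) (y := y / g) (by positivity) (by
    simp only [Finset.forall_mem_image]
    intro l hl
    rw [div_lt_iff₀ hg']
    have h := hF l (Finset.mem_filter.mp hl).1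
    have h' : (l : ℝ) = g * ((l / g : ℕ) : ℝ) := by exact_mod_cast rep l hl
    linarith)
  rw [Finset.sum_image inj] at h1
  calc ∑ l ∈ F', (Nat.gcd l W : ℝ) / (l : ℝ) ^ 2
      = (g : ℝ)⁻¹ * ∑ l ∈ F', (((l / g : ℕ) : ℝ) ^ 2)⁻¹ := by
        rw [Finset.mul_sum]
        refine Finset.sum_congr rfl (fun l hl => ?_)
        have h' : (l : ℝ) = g * ((l / g : ℕ) : ℝ) := by exact_mod_cast rep l hl
        rw [(Finset.mem_filter.mp hl).2]
        nth_rewrite 1 [h']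
        rw [mul_pow, div_eq_mul_inv, mul_inv]
        field_simp
    _ ≤ (g : ℝ)⁻¹ * (2 / (y / g)) := by gcongr
    _ = 2 / y := by field_simp

theorem card_le_of_small_square_divisor (T : Finset (ℤ × ℤ)) {a h L : ℕ} {Y K : ℝ} (hY : 0 < Y)
    (hK : 0 ≤ K)
    (hT : ∀ p ∈ T, p.1 ≠ 0 ∧ |p.1| ≤ a ∧ |p.2| ≤ h ∧
      ∃ l : ℕ, Y < l ∧ l ≤ L ∧ (l : ℤ) ^ 2 ∣ 4 * p.1 ^ 3 + 27 * p.2 ^ 2)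
    (hK₁ : ∀ l : ℕ, l ≠ 0 → l ≤ L → ((l ^ 2).divisors.card : ℝ) ≤ K)
    (hK₂ : ∀ A : ℤ, A ≠ 0 → |A| ≤ a → ((432 * A ^ 3).natAbs.divisors.card : ℝ) ≤ K) :
    (T.card : ℝ) ≤ (2 * a + 1) * (K * (54 * h * (K * (2 / Y)) + L)) := by
  have hcardI : ((Finset.Icc (-(a : ℤ)) a).card : ℝ) = 2 * a + 1 := by
    rw [Int.card_Icc]
    have : ((a : ℤ) + 1 - -(a : ℤ)).toNat = 2 * a + 1 := by omega
    rw [this]; push_cast; ring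
  rw [← hcardI]
  refine Finset.card_le_card_mul_of_fibers T _ Prod.fst
    (fun p hp => Finset.mem_Icc.mpr (abs_le.mp (hT p hp).2.1)) (fun A _ => ?_)
  set T' := T.filter (fun p => p.1 = A) with hT'
  rcases T'.eq_empty_or_nonempty with he | ⟨p₀, hp₀⟩
  · rw [he]; simp only [Finset.card_empty, Nat.cast_zero]; positivity
  have hp₀' := Finset.mem_filter.mp hp₀
  have hA0 : A ≠ 0 := hp₀'.2 ▸ (hT p₀ hp₀'.1).1
  have hAa : |A| ≤ a := hp₀'.2 ▸ (hT p₀ hp₀'.1).2.1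
  set F := (Finset.Icc 1 L).filter (fun l : ℕ => Y < l) with hF
  set R : ℕ → Finset ℤ := fun l =>
    (Finset.Icc (-(h : ℤ)) h).filter (fun B => (l : ℤ) ^ 2 ∣ 4 * A ^ 3 + 27 * B ^ 2) with hR
  have hcard : (T'.image Prod.snd).card = T'.card :=
    Finset.card_image_of_injOn (fun p hp q hq hpq => Prod.ext
      ((Finset.mem_filter.mp hp).2.trans (Finset.mem_filter.mp hq).2.symm) hpq)
  have hsub : T'.image Prod.snd ⊆ F.biUnion R := by
    intro B hB
    obtain ⟨p, hp, rfl⟩ := Finset.mem_image.mp hB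
    obtain ⟨hpT, hpA⟩ := Finset.mem_filter.mp hp
    obtain ⟨-, -, hp2, l, hYl, hlL, hl⟩ := hT p hpT
    have hl1 : 1 ≤ l := by
      have : (0 : ℝ) < l := hY.trans hYl
      exact_mod_cast this
    refine Finset.mem_biUnion.mpr ⟨l, ?_, ?_⟩
    · simp [hF, hl1, hlL, hYl]
    · rw [hpA] at hl
      exact Finset.mem_filter.mpr ⟨Finset.mem_Icc.mpr (abs_le.mp hp2), hl⟩
  have h1 : (T'.card : ℝ) ≤ ∑ l ∈ F, ((R l).card : ℝ) := by
    rw [← hcard]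
    exact_mod_cast (Finset.card_le_card hsub).trans Finset.card_biUnion_le
  refine h1.trans ?_
  have hFl : ∀ l ∈ F, l ≠ 0 ∧ l ≤ L ∧ Y < l := by
    intro l hl
    simp only [hF, Finset.mem_filter, Finset.mem_Icc] at hl
    exact ⟨by omega, hl.1.2, hl.2⟩
  calc ∑ l ∈ F, ((R l).card : ℝ)
      ≤ ∑ l ∈ F, K * (54 * h * (Nat.gcd l (432 * A ^ 3).natAbs / (l : ℝ) ^ 2) + 1) := by
        refine Finset.sum_le_sum (fun l hl => ?_)
        refine (card_roots_le A (hFl l hl).1 h (R l) (fun B hB => ?_) (fun B hB => ?_)).trans ?_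
        · exact abs_le.mpr (Finset.mem_Icc.mp (Finset.mem_filter.mp hB).1)
        · exact (Finset.mem_filter.mp hB).2
        · gcongr
          exact hK₁ l (hFl l hl).1 (hFl l hl).2.1
    _ = K * (54 * h * (∑ l ∈ F, (Nat.gcd l (432 * A ^ 3).natAbs : ℝ) / (l : ℝ) ^ 2) + F.card) := by
        rw [← Finset.mul_sum, Finset.sum_add_distrib, ← Finset.mul_sum]
        simp
    _ ≤ K * (54 * h * (K * (2 / Y)) + L) := by
        gcongr
        · refine (sum_gcd_div_sq_le F hY (fun l hl => (hFl l hl).2.2) ?_).trans ?_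
          · simpa using hA0
          · gcongr
            exact hK₂ A hA0 hAa
        · calc F.card ≤ (Finset.Icc 1 L).card := Finset.card_filter_le _ _
            _ = L := by simp

set_option maxHeartbeats 1000000 in
theorem card_le_of_large_square_divisor (T : Finset (ℤ × ℤ)) {a M Z : ℕ} {K : ℝ} (hZ : 1 ≤ Z)
    (hK : 0 ≤ K)
    (hT : ∀ p ∈ T, p.1 ≠ 0 ∧ |p.1| ≤ a ∧ 9 * p.2.natAbs ≤ Z ∧
      ∃ l m : ℕ, Squarefree m ∧ m ≤ M ∧ l ≤ Z ∧
        (4 * p.1 ^ 3 + 27 * p.2 ^ 2).natAbs = m * l ^ 2)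
    (hK₁ : ∀ A : ℤ, A ≠ 0 → |A| ≤ a → ((-12 * A ^ 3).natAbs.divisors.card : ℝ) ≤ K) :
    (T.card : ℝ) ≤ (2 * a + 1) * (2 * M + 1) * 2 *
      (K * (K * (7 * Real.log (Z * (1 + √(3 * M))) + 13))) := by
  have hT2 : ∀ p ∈ T, ∃ (l : ℕ) (μ : ℤ), Squarefree μ.natAbs ∧ |μ| ≤ M ∧ l ≤ Z ∧
      4 * p.1 ^ 3 + 27 * p.2 ^ 2 = μ * (l : ℤ) ^ 2 := by
    intro p hp
    obtain ⟨-, -, -, l, m, hm, hmM, hlZ, h⟩ := hT p hp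
    rcases Int.natAbs_eq (4 * p.1 ^ 3 + 27 * p.2 ^ 2) with h' | h'
    · exact ⟨l, m, by simpa using hm, by simpa using hmM, hlZ, by rw [h', h]; push_cast; ring⟩
    · exact ⟨l, -m, by simpa using hm, by simpa using hmM, hlZ, by rw [h', h]; push_cast; ring⟩
  choose! l μ hμ hμM hlZ hD using hT2
  have hcardI : ∀ b : ℕ, (Finset.Icc (-(b : ℤ)) b).card = 2 * b + 1 := by
    intro b
    rw [Int.card_Icc]; omega
  have hcardD : ((Finset.Icc (-(a : ℤ)) a ×ˢ Finset.Icc (-(M : ℤ)) M ×ˢ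
      (Finset.univ : Finset Bool)).card : ℝ) = (2 * a + 1) * (2 * M + 1) * 2 := by
    rw [Finset.card_product, Finset.card_product, hcardI, hcardI, Finset.card_univ,
      Fintype.card_bool]
    push_cast; ring
  have hZ' : (1 : ℝ) ≤ Z := by exact_mod_cast hZ
  have hlog : 0 ≤ Real.log (Z * (1 + √(3 * M))) :=
    Real.log_nonneg (by nlinarith [Real.sqrt_nonneg (3 * (M : ℝ))])
  rw [← hcardD]
  refine Finset.card_le_card_mul_of_fibers T _ (fun p => (p.1, μ p, decide (0 ≤ p.2)))
    (fun p hp => ?_) (fun c _ => ?_)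
  · simp only [Finset.mem_product, Finset.mem_Icc, Finset.mem_univ, and_true]
    exact ⟨abs_le.mp (hT p hp).2.1, abs_le.mp (hμM p hp)⟩
  obtain ⟨A, ν, σ⟩ := c
  set T' := T.filter (fun p => (p.1, μ p, decide (0 ≤ p.2)) = (A, ν, σ)) with hT'
  rcases T'.eq_empty_or_nonempty with he | ⟨p₀, hp₀⟩
  · rw [he]; simp only [Finset.card_empty, Nat.cast_zero]; positivity
  have mem : ∀ p ∈ T', p ∈ T ∧ p.1 = A ∧ μ p = ν ∧ decide (0 ≤ p.2) = σ := by
    intro p hp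
    simpa [hT'] using hp
  obtain ⟨h0T, h0A, h0ν, -⟩ := mem p₀ hp₀
  have hA0 : A ≠ 0 := h0A ▸ (hT p₀ h0T).1
  have hAa : |A| ≤ a := h0A ▸ (hT p₀ h0T).2.1
  have hν : Squarefree ν.natAbs := h0ν ▸ hμ p₀ h0T
  have hνM : |ν| ≤ M := h0ν ▸ hμM p₀ h0T
  have hcard : (T'.image (fun p => (9 * p.2.natAbs, l p))).card = T'.card := by
    refine Finset.card_image_of_injOn (fun p hp q hq hpq => ?_)
    obtain ⟨-, hpA, -, hps⟩ := mem p hp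
    obtain ⟨-, hqA, -, hqs⟩ := mem q hq
    have h1 : p.2.natAbs = q.2.natAbs := by
      have := (Prod.mk.inj hpq).1
      omega
    have h2 : (0 ≤ p.2) ↔ (0 ≤ q.2) := decide_eq_decide.mp (hps.trans hqs.symm)
    exact Prod.ext (hpA.trans hqA.symm) (by omega)
  have hs := card_solutions_le (n := 3 * ν) (N := -12 * A ^ 3) hν (by simp [Int.natAbs_mul])
    (by simpa using hA0) hZ
    (T'.image (fun p => (9 * p.2.natAbs, l p)))
    (by
      simp only [Finset.forall_mem_image]
      intro p hp
      obtain ⟨hpT, hpA, hpν, -⟩ := mem p hp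
      have h := hD p hpT
      rw [hpA, hpν] at h
      push_cast
      rw [mul_pow, sq_abs]
      linear_combination 3 * h)
    (by
      simp only [Finset.forall_mem_image]
      intro p hp
      exact ⟨(hT p (mem p hp).1).2.2.1, hlZ p (mem p hp).1⟩)
  rw [hcard] at hs
  have hνM' : |((3 * ν : ℤ) : ℝ)| ≤ 3 * M := by
    push_cast
    rw [abs_mul, abs_of_pos (by norm_num : (0 : ℝ) < 3)]
    have : |(ν : ℝ)| ≤ M := by exact_mod_cast hνM
    linarith
  refine hs.trans ?_
  have hk := hK₁ A hA0 hAa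
  have hlog' : Real.log (Z * (1 + √|((3 * ν : ℤ) : ℝ)|)) ≤ Real.log (Z * (1 + √(3 * M))) := by
    gcongr
  have hlog'' : 0 ≤ Real.log (Z * (1 + √|((3 * ν : ℤ) : ℝ)|)) :=
    Real.log_nonneg (by nlinarith [Real.sqrt_nonneg |((3 * ν : ℤ) : ℝ)|])
  gcongr

theorem exists_sqPart_eq_four_mul {D : ℤ} (hD : D ≠ 0) : ∃ l m : ℕ, Squarefree m ∧
    sqPart (-16 * D) = 4 * l ∧ D.natAbs = m * l ^ 2 := by
  have h0 : (-16 * D).natAbs ≠ 0 := by simpa using hD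
  obtain ⟨m, hm, h⟩ := exists_sq_mul_sqPart _ h0
  change _ = m * sqPart (-16 * D) ^ 2 at h
  have h16 : (-16 * D).natAbs = 16 * D.natAbs := by rw [Int.natAbs_mul]; rfl
  rw [h16] at h
  have hs : sqPart (-16 * D) ≠ 0 := by
    intro h'; rw [h'] at h; simp at h; exact hD h
  have h4 : 4 ∣ sqPart (-16 * D) := by
    refine Nat.dvd_of_sq_dvd_sq_mul_squarefree hm hs ⟨D.natAbs, ?_⟩
    rw [mul_comm, ← h]; norm_num
  obtain ⟨l, hl⟩ := h4
  refine ⟨l, m, hm, hl, ?_⟩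
  rw [hl] at h
  have : 16 * D.natAbs = 16 * (m * l ^ 2) := by rw [h]; ring
  exact Nat.eq_of_mul_eq_mul_left (by norm_num) this

theorem rpow_third_cubed {X : ℝ} (hX : 0 ≤ X) : (X ^ (1 / 3 : ℝ)) ^ 3 = X := by
  rw [← Real.rpow_natCast, ← Real.rpow_mul hX]; norm_num

theorem rpow_half_sq {X : ℝ} (hX : 0 ≤ X) : (X ^ (1 / 2 : ℝ)) ^ 2 = X := by
  rw [← Real.rpow_natCast, ← Real.rpow_mul hX]; norm_num

theorem bounds_of_Eheight_le {X : ℝ} (hX : 0 ≤ X) {A B : ℤ} (h : (Eheight A B : ℝ) ≤ X) :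
    4 * |(A : ℝ)| ^ 3 ≤ X ∧ 27 * (B : ℝ) ^ 2 ≤ X ∧ |(A : ℝ)| ≤ X ^ (1 / 3 : ℝ) ∧
      |(B : ℝ)| ≤ X ^ (1 / 2 : ℝ) := by
  unfold Eheight at h
  rw [Int.cast_max, max_le_iff] at h
  push_cast at h
  obtain ⟨h1, h2⟩ := h
  refine ⟨h1, h2, ?_, ?_⟩
  · refine le_of_pow_le_pow_left₀ three_ne_zero (by positivity) ?_
    rw [rpow_third_cubed hX]
    have : 0 ≤ |(A : ℝ)| ^ 3 := by positivity
    linarith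
  · refine le_of_pow_le_pow_left₀ two_ne_zero (by positivity) ?_
    rw [rpow_half_sq hX, sq_abs]
    nlinarith [sq_nonneg (B : ℝ)]

theorem exists_card_divisors_le_of_le {η : ℝ} (hη : 0 < η) :
    ∃ c : ℝ, 0 < c ∧ ∀ X : ℝ, 1 ≤ X → ∀ n : ℕ, n ≠ 0 → (n : ℝ) ≤ 432 * X →
      (n.divisors.card : ℝ) ≤ c * X ^ η := by
  obtain ⟨C, hC, h⟩ := exists_card_divisors_le_rpow hη
  refine ⟨C * 432 ^ η, by positivity, fun X hX n hn hnX => (h n hn).trans ?_⟩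
  rw [mul_assoc, ← Real.mul_rpow (by norm_num) (by linarith)]
  gcongr

theorem log_solution_range_le {η : ℝ} (hη : 0 < η) {X : ℝ} (hX : 1 ≤ X) :
    7 * Real.log (63 * X ^ 2) + 13 ≤ (7 * (63 ^ (η / 2) / (η / 2)) + 13) * X ^ η := by
  have h1 := Real.log_le_rpow_div (x := 63 * X ^ 2) (by positivity) (half_pos hη)
  have h2 : (63 * X ^ 2) ^ (η / 2) = 63 ^ (η / 2) * X ^ η := by
    rw [Real.mul_rpow (by norm_num) (by positivity), ← Real.rpow_natCast,
      ← Real.rpow_mul (by linarith)]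
    congr 2; push_cast; ring
  rw [h2] at h1
  have h3 : 1 ≤ X ^ η := Real.one_le_rpow hX hη.le
  calc 7 * Real.log (63 * X ^ 2) + 13
      ≤ 7 * (63 ^ (η / 2) * X ^ η / (η / 2)) + 13 * X ^ η := by linarith
    _ = _ := by ring

set_option maxHeartbeats 2000000 in
/-- `#{E_{A,B} ∈ 𝓕(X) : sq(Δ(E_{A,B})) > 4X^δ} ≪ X^{5/6 - 5δ/6}` for fixed `δ ∈ (0, 1/6)`. -/
theorem large_square_part_count (δ : ℝ) (hδ : δ ∈ Set.Ioo (0 : ℝ) (1 / 6)) :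
    ∃ C : ℝ, 0 < C ∧ ∀ X : ℝ, 1 ≤ X →
      (Nat.card {p : ℤ × ℤ // p ∈ FX X ∧ 4 * X ^ δ < (sqPart (discAB p.1 p.2) : ℝ)} : ℝ) ≤
        C * X ^ (5 / 6 - 5 * δ / 6) := by
  classical
  obtain ⟨hδ0, hδ6⟩ := hδ
  have hη : 0 < δ / 18 := by positivity
  obtain ⟨c₁, hc₁, hτ⟩ := exists_card_divisors_le_of_le hη
  set η := δ / 18 with hηdef
  set c₂ : ℝ := 7 * (63 ^ (η / 2) / (η / 2)) + 13 with hc₂def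
  have hc₂ : 0 < c₂ := by positivity
  refine ⟨3 + (324 * c₁ ^ 2 + 3 * c₁) + 30 * c₁ ^ 2 * c₂, by positivity, fun X hX => ?_⟩
  have hX0 : (0 : ℝ) < X := by linarith
  have mono : ∀ {s t : ℝ}, s ≤ t → X ^ s ≤ X ^ t := fun h => Real.rpow_le_rpow_of_exponent_le hX h
  set E : ℝ := 5 / 6 - 5 * δ / 6 with hE
  set a' : ℝ := X ^ (1 / 3 : ℝ) with ha'
  set h' : ℝ := X ^ (1 / 2 : ℝ) with hh'
  have ha1 : 1 ≤ a' := Real.one_le_rpow hX (by norm_num)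
  have hh1 : 1 ≤ h' := Real.one_le_rpow hX (by norm_num)
  have ha3 : a' ^ 3 = X := rpow_third_cubed hX0.le
  have hh2 : h' ^ 2 = X := rpow_half_sq hX0.le
  have haX : a' ≤ X := by nlinarith [sq_nonneg (a' - 1)]
  have hhX : h' ≤ X := by nlinarith
  set a : ℕ := ⌊a'⌋₊ with ha
  set h : ℕ := ⌊h'⌋₊ with hh
  have haf : (a : ℝ) ≤ a' := Nat.floor_le (by linarith)
  have hhf : (h : ℝ) ≤ h' := Nat.floor_le (by linarith)
  set Y : ℝ := X ^ δ with hY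
  have hYpos : 0 < Y := by positivity
  set K : ℝ := c₁ * X ^ η with hK
  have hKpos : 0 < K := by positivity
  set U : Finset (ℤ × ℤ) := (Finset.Icc (-(a : ℤ)) a ×ˢ Finset.Icc (-(h : ℤ)) h).filter
    (fun p => p ∈ FX X ∧ 4 * X ^ δ < (sqPart (discAB p.1 p.2) : ℝ)) with hU
  have box : ∀ p ∈ FX X, |p.1| ≤ a ∧ |p.2| ≤ h := by
    intro p hp
    obtain ⟨-, -, h3, h4⟩ := bounds_of_Eheight_le hX0.le hp.2
    have e : ∀ z : ℤ, |(z : ℝ)| = (z.natAbs : ℝ) := fun z => by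
      rw [Nat.cast_natAbs, Int.cast_abs]
    rw [e] at h3 h4
    have h3' : p.1.natAbs ≤ a := Nat.le_floor h3
    have h4' : p.2.natAbs ≤ h := Nat.le_floor h4
    rw [Int.abs_eq_natAbs, Int.abs_eq_natAbs]
    exact ⟨by exact_mod_cast h3', by exact_mod_cast h4'⟩
  have hcard : Nat.card {p : ℤ × ℤ // p ∈ FX X ∧ 4 * X ^ δ < (sqPart (discAB p.1 p.2) : ℝ)}
      = U.card := by
    refine Nat.subtype_card U (fun p => ?_)
    rw [hU, Finset.mem_filter, and_iff_right_iff_imp]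
    intro hp
    obtain ⟨b1, b2⟩ := box p hp.1
    exact Finset.mem_product.mpr
      ⟨Finset.mem_Icc.mpr (abs_le.mp b1), Finset.mem_Icc.mpr (abs_le.mp b2)⟩
  rw [hcard]
  have hUmem : ∀ p ∈ U, p ∈ FX X ∧ ∃ l m : ℕ, Squarefree m ∧ Y < l ∧
      (4 * p.1 ^ 3 + 27 * p.2 ^ 2).natAbs = m * l ^ 2 := by
    intro p hp
    obtain ⟨-, hpF, hpY⟩ := Finset.mem_filter.mp hp
    obtain ⟨l, m, hm, hl, hD⟩ := exists_sqPart_eq_four_mul hpF.1.1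
    refine ⟨hpF, l, m, hm, ?_, hD⟩
    unfold discAB at hpY
    rw [hl] at hpY
    push_cast at hpY
    linarith
  have hsmall : ∀ A : ℤ, A ≠ 0 → |A| ≤ a → |(A : ℝ)| ^ 3 ≤ X := by
    intro A _ hA
    have : |(A : ℝ)| ≤ a := by exact_mod_cast hA
    rw [← ha3]
    gcongr
    linarith
  set U₀ := U.filter (fun p => p.1 = 0) with hU₀
  set U₁ := U.filter (fun p => p.1 ≠ 0 ∧ ∃ l : ℕ, Y < l ∧ l ≤ a ∧
    (l : ℤ) ^ 2 ∣ 4 * p.1 ^ 3 + 27 * p.2 ^ 2) with hU₁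
  set U₂ := U.filter (fun p => p.1 ≠ 0 ∧ ∃ l m : ℕ, Squarefree m ∧ a < l ∧
    (4 * p.1 ^ 3 + 27 * p.2 ^ 2).natAbs = m * l ^ 2) with hU₂
  have hcover : U ⊆ U₀ ∪ U₁ ∪ U₂ := by
    intro p hp
    obtain ⟨-, l, m, hm, hl, hD⟩ := hUmem p hp
    simp only [Finset.mem_union]
    by_cases h0 : p.1 = 0
    · exact Or.inl (Or.inl (Finset.mem_filter.mpr ⟨hp, h0⟩))
    rcases le_or_gt l a with hla | hla
    · refine Or.inl (Or.inr (Finset.mem_filter.mpr ⟨hp, h0, l, hl, hla, ?_⟩))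
      rw [← Int.dvd_natAbs, hD]
      exact_mod_cast Dvd.intro_left m rfl
    · exact Or.inr (Finset.mem_filter.mpr ⟨hp, h0, l, m, hm, hla, hD⟩)
  have hsum : (U.card : ℝ) ≤ U₀.card + U₁.card + U₂.card := by
    have := (Finset.card_le_card hcover).trans ((Finset.card_union_le _ _).trans
      (Nat.add_le_add_right (Finset.card_union_le _ _) _))
    exact_mod_cast this
  have b₀ : (U₀.card : ℝ) ≤ 3 * X ^ E := by
    have h1 : U₀ ⊆ ({0} : Finset ℤ) ×ˢ Finset.Icc (-(h : ℤ)) h := by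
      intro p hp
      obtain ⟨hpU, hp0⟩ := Finset.mem_filter.mp hp
      have := (box p (hUmem p hpU).1).2
      exact Finset.mem_product.mpr
        ⟨Finset.mem_singleton.mpr hp0, Finset.mem_Icc.mpr (abs_le.mp this)⟩
    have h2 := Finset.card_le_card h1
    rw [Finset.card_product, Finset.card_singleton, one_mul, Int.card_Icc] at h2
    have h3 : U₀.card ≤ 2 * h + 1 := by omega
    have h4 : (U₀.card : ℝ) ≤ 2 * h + 1 := by exact_mod_cast h3
    have h5 : h' ≤ X ^ E := mono (by rw [hE]; linarith)
    linarith
  have b₁ : (U₁.card : ℝ) ≤ (324 * c₁ ^ 2 + 3 * c₁) * X ^ E := by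
    have := card_le_of_small_square_divisor U₁ (a := a) (h := h) (L := a) hYpos hKpos.le
      (fun p hp => by
        obtain ⟨hpU, hp0, hl⟩ := Finset.mem_filter.mp hp
        obtain ⟨b1, b2⟩ := box p (hUmem p hpU).1
        exact ⟨hp0, b1, b2, hl⟩)
      (fun l hl hla => hτ X hX _ (by positivity) (by
        have h1 : (l : ℝ) ≤ a' := le_trans (by exact_mod_cast hla) haf
        have h2 : (l : ℝ) ^ 2 ≤ a' ^ 2 := by gcongr
        push_cast
        nlinarith))
      (fun A hA hAa => hτ X hX _ (by simpa using hA) (by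
        have := hsmall A hA hAa
        rw [Nat.cast_natAbs, Int.cast_abs]
        push_cast
        rw [abs_mul, abs_pow, abs_of_pos (by norm_num : (0 : ℝ) < 432)]
        linarith))
    refine this.trans ?_
    calc (2 * (a : ℝ) + 1) * (K * (54 * h * (K * (2 / Y)) + a))
        ≤ (3 * a') * (K * (54 * h' * (K * (2 / Y)) + a')) := by gcongr; linarith
      _ = 324 * c₁ ^ 2 * (a' * X ^ η * h' * X ^ η * Y⁻¹) + 3 * c₁ * (a' * X ^ η * a') := by
          rw [hK]; ring
      _ = 324 * c₁ ^ 2 * X ^ (1 / 3 + η + 1 / 2 + η + -δ) + 3 * c₁ * X ^ (1 / 3 + η + 1 / 3) := by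
          rw [ha', hh', hY, ← Real.rpow_neg hX0.le]
          simp only [Real.rpow_add hX0]
      _ ≤ 324 * c₁ ^ 2 * X ^ E + 3 * c₁ * X ^ E := by
          gcongr
          · rw [hE, hηdef]; linarith
          · rw [hE, hηdef]; linarith
      _ = _ := by ring
  have b₂ : (U₂.card : ℝ) ≤ 30 * c₁ ^ 2 * c₂ * X ^ E := by
    set M : ℕ := ⌊2 * a'⌋₊ with hM
    set Z : ℕ := ⌊9 * h'⌋₊ with hZ
    have hMf : (M : ℝ) ≤ 2 * a' := Nat.floor_le (by linarith)
    have hZf : (Z : ℝ) ≤ 9 * h' := Nat.floor_le (by linarith)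
    have hZ1 : 1 ≤ Z := Nat.le_floor (by push_cast; linarith)
    have := card_le_of_large_square_divisor U₂ (a := a) (M := M) (Z := Z) hZ1 hKpos.le
      (fun p hp => by
        obtain ⟨hpU, hp0, l, m, hm, hla, hD⟩ := Finset.mem_filter.mp hp
        have hpF := (hUmem p hpU).1
        obtain ⟨b1, b2⟩ := box p hpF
        obtain ⟨q1, q2, -, q4⟩ := bounds_of_Eheight_le hX0.le hpF.2
        have hDX : (m : ℝ) * (l : ℝ) ^ 2 ≤ 2 * X := by
          have e : (m : ℝ) * (l : ℝ) ^ 2 = |4 * (p.1 : ℝ) ^ 3 + 27 * (p.2 : ℝ) ^ 2| := by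
            have : ((m * l ^ 2 : ℕ) : ℝ) = ((4 * p.1 ^ 3 + 27 * p.2 ^ 2).natAbs : ℝ) := by
              rw [hD]
            rw [Nat.cast_natAbs, Int.cast_abs] at this
            push_cast at this
            exact this
          rw [e]
          refine (abs_add_le _ _).trans ?_
          rw [abs_mul, abs_pow, abs_of_pos (by norm_num : (0 : ℝ) < 4),
            abs_of_nonneg (by positivity : 0 ≤ 27 * (p.2 : ℝ) ^ 2)]
          linarith
        have hal : a' < l := (Nat.floor_lt (by linarith)).mp hla
        have hm1 : (1 : ℝ) ≤ m := by exact_mod_cast Nat.one_le_iff_ne_zero.mpr hm.ne_zero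
        refine ⟨hp0, b1, Nat.le_floor ?_, l, m, hm, Nat.le_floor ?_, Nat.le_floor ?_, hD⟩
        · push_cast
          rw [Nat.cast_natAbs, Int.cast_abs]
          linarith
        · have h1 : (m : ℝ) * a' ^ 2 ≤ (2 * a') * a' ^ 2 := by
            calc (m : ℝ) * a' ^ 2 ≤ m * (l : ℝ) ^ 2 := by gcongr
              _ ≤ 2 * X := hDX
              _ = (2 * a') * a' ^ 2 := by rw [← ha3]; ring
          exact le_of_mul_le_mul_right h1 (by positivity)
        · refine le_of_pow_le_pow_left₀ two_ne_zero (by positivity) ?_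
          rw [mul_pow, hh2]
          nlinarith [sq_nonneg (l : ℝ)])
      (fun A hA hAa => hτ X hX _ (by simpa using hA) (by
        have := hsmall A hA hAa
        rw [Nat.cast_natAbs, Int.cast_abs]
        push_cast
        rw [abs_mul, abs_pow, abs_neg, abs_of_pos (by norm_num : (0 : ℝ) < 12)]
        linarith))
    refine this.trans ?_
    have hlog : 7 * Real.log (Z * (1 + √(3 * M))) + 13 ≤ c₂ * X ^ η := by
      refine le_trans ?_ (log_solution_range_le hη hX)
      have hZ' : (1 : ℝ) ≤ Z := by exact_mod_cast hZ1
      have hs : √(3 * (M : ℝ)) ≤ 6 * X :=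
        Real.sqrt_le_iff.mpr ⟨by positivity, by
          have : X ≤ X ^ 2 := by rw [sq]; exact le_mul_of_one_le_left hX0.le hX
          linarith [mul_pow 6 X 2]⟩
      have hle : (Z : ℝ) * (1 + √(3 * M)) ≤ 63 * X ^ 2 := by
        calc (Z : ℝ) * (1 + √(3 * M)) ≤ (9 * X) * (7 * X) := by
              gcongr
              · linarith
              · linarith
          _ = 63 * X ^ 2 := by ring
      gcongr
    calc (2 * (a : ℝ) + 1) * (2 * M + 1) * 2 *
          (K * (K * (7 * Real.log (Z * (1 + √(3 * M))) + 13)))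
        ≤ (2 * (a : ℝ) + 1) * (2 * M + 1) * 2 * (K * (K * (c₂ * X ^ η))) := by gcongr
      _ ≤ (3 * a') * (5 * a') * 2 * (K * (K * (c₂ * X ^ η))) := by
          gcongr
          · linarith
          · linarith
      _ = 30 * c₁ ^ 2 * c₂ * (a' * a' * X ^ η * X ^ η * X ^ η) := by rw [hK]; ring
      _ = 30 * c₁ ^ 2 * c₂ * X ^ (1 / 3 + 1 / 3 + η + η + η) := by
          rw [ha']
          simp only [Real.rpow_add hX0]
      _ ≤ 30 * c₁ ^ 2 * c₂ * X ^ E := by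
          gcongr
          · rw [hE, hηdef]; linarith
  calc (U.card : ℝ) ≤ U₀.card + U₁.card + U₂.card := hsum
    _ ≤ 3 * X ^ E + (324 * c₁ ^ 2 + 3 * c₁) * X ^ E + 30 * c₁ ^ 2 * c₂ * X ^ E := by gcongr
    _ = _ := by ring
end

section
/- Let δ ∈ (0,1) and ε > 0 be fixed. Then #𝓔_δ^{(1)}(X) ≪ X^{2/3 + ε}, with implied constant depending only on δ and ε. -/
/-- The set `𝓔_δ(X)` of quadruples `(A, B, m, ℓ)` of nonzero integers (with `ℓ ≥ 1`) such that
`|A|³ ≤ X`, `B² ≤ X`, `ℓ > X^δ` and `4A³ + 27B² = mℓ²`. -/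
def Eset (δ X : ℝ) : Set (ℤ × ℤ × ℤ × ℤ) :=
  {t | t.1 ≠ 0 ∧ t.2.1 ≠ 0 ∧ t.2.2.1 ≠ 0 ∧ 1 ≤ t.2.2.2 ∧
    (|t.1| ^ 3 : ℝ) ≤ X ∧ ((t.2.1 : ℝ) ^ 2 : ℝ) ≤ X ∧ X ^ δ < (t.2.2.2 : ℝ) ∧
    4 * t.1 ^ 3 + 27 * t.2.1 ^ 2 = t.2.2.1 * t.2.2.2 ^ 2}

/-- The subset `𝓔_δ^{(1)}(X)` where moreover `ℓ > X^{1/3}`. -/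
def Eset1 (δ X : ℝ) : Set (ℤ × ℤ × ℤ × ℤ) :=
  {t ∈ Eset δ X | X ^ ((1 : ℝ) / 3) < (t.2.2.2 : ℝ)}

/-- The subset `𝓔_δ^{(2)}(X) = 𝓔_δ(X) ∖ 𝓔_δ^{(1)}(X)`. -/
def Eset2 (δ X : ℝ) : Set (ℤ × ℤ × ℤ × ℤ) := Eset δ X \ Eset1 δ X

theorem card_divisors_le_rpow (ε : ℝ) (hε : 0 < ε) :
    ∃ C : ℝ, 1 ≤ C ∧ ∀ n : ℕ, n ≠ 0 → (n.divisors.card : ℝ) ≤ C * (n : ℝ) ^ ε := by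
  obtain ⟨P, hP⟩ := exists_nat_ge ((2 : ℝ) ^ (1 / ε))
  have hl : 0 < ε * Real.log 2 := mul_pos hε (Real.log_pos one_lt_two)
  set K : ℝ := 1 + 1 / (ε * Real.log 2) with hK
  have hK1 : 1 ≤ K := by
    have : 0 < 1 / (ε * Real.log 2) := by positivity
    linarith
  refine ⟨K ^ P, one_le_pow₀ hK1, fun n hn => ?_⟩
  have hlocal : ∀ p ∈ n.primeFactors, ((n.factorization p + 1 : ℕ) : ℝ) ≤
      (if p < P then K else 1) * ((p : ℝ) ^ n.factorization p) ^ ε := by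
    intro p hp
    have hp2 : (2 : ℝ) ≤ p := by exact_mod_cast (Nat.prime_of_mem_primeFactors hp).two_le
    have hp0 : (0 : ℝ) ≤ p := by linarith
    generalize n.factorization p = k
    rw [← Real.rpow_natCast, ← Real.rpow_mul hp0, mul_comm (k : ℝ) ε, Real.rpow_mul hp0,
      Real.rpow_natCast]
    split_ifs with h
    · have h1 : 1 + ε * Real.log 2 ≤ (p : ℝ) ^ ε := by
        calc 1 + ε * Real.log 2 ≤ Real.exp (ε * Real.log 2) := by
              linarith [Real.add_one_le_exp (ε * Real.log 2)]
          _ = 2 ^ ε := by rw [Real.rpow_def_of_pos two_pos, mul_comm]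
          _ ≤ (p : ℝ) ^ ε := Real.rpow_le_rpow two_pos.le hp2 hε.le
      have h2 : 1 + (k : ℝ) * (ε * Real.log 2) ≤ ((p : ℝ) ^ ε) ^ k :=
        (one_add_mul_le_pow (by linarith) k).trans (pow_le_pow_left₀ (by linarith) h1 k)
      have h3 : K * (1 + (k : ℝ) * (ε * Real.log 2)) =
          1 + k + (k : ℝ) * (ε * Real.log 2) + 1 / (ε * Real.log 2) := by
        rw [hK]; field_simp; ring
      have h4 : 0 ≤ (k : ℝ) * (ε * Real.log 2) + 1 / (ε * Real.log 2) := by positivity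
      have h5 := mul_le_mul_of_nonneg_left h2 (zero_le_one.trans hK1)
      push_cast
      linarith
    · have h1 : (2 : ℝ) ≤ (p : ℝ) ^ ε := by
        have h2 : (2 : ℝ) ^ (1 / ε) ≤ p := hP.trans (by exact_mod_cast not_lt.mp h)
        calc (2 : ℝ) = ((2 : ℝ) ^ (1 / ε)) ^ ε := by
              rw [← Real.rpow_mul two_pos.le, one_div_mul_cancel hε.ne', Real.rpow_one]
          _ ≤ (p : ℝ) ^ ε := Real.rpow_le_rpow (by positivity) h2 hε.le
      have h2 : ((k + 1 : ℕ) : ℝ) ≤ 2 ^ k := by exact_mod_cast (Nat.lt_two_pow_self (n := k))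
      rw [one_mul]
      exact h2.trans (pow_le_pow_left₀ two_pos.le h1 k)
  rw [Nat.card_divisors hn, Nat.cast_prod]
  refine (Finset.prod_le_prod (fun _ _ => Nat.cast_nonneg _) hlocal).trans ?_
  rw [Finset.prod_mul_distrib, Real.finsetProd_rpow _ _ (fun _ _ => by positivity)]
  have hn' : ∏ p ∈ n.primeFactors, (p : ℝ) ^ n.factorization p = n := by
    exact_mod_cast Nat.prod_factorization_pow_eq_self hn
  rw [hn']
  refine mul_le_mul_of_nonneg_right ?_ (by positivity)
  rw [← Finset.prod_filter, Finset.prod_const]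
  refine pow_le_pow_right₀ hK1 ?_
  calc _ ≤ (Finset.range P).card := Finset.card_le_card fun p hp => by
        simpa using (Finset.mem_filter.mp hp).2
    _ = P := Finset.card_range P

theorem dvd_two_mul_cross_of_gcd_eq {D N x₀ y₀ x₁ y₁ x₂ y₂ : ℤ} (hD : Squarefree D)
    (h₀ : x₀ ^ 2 - D * y₀ ^ 2 = N) (h₁ : x₁ ^ 2 - D * y₁ ^ 2 = N)
    (c₀ : IsCoprime x₀ y₀) (c₁ : IsCoprime x₁ y₁)
    (h₂ : x₂ ^ 2 - D * y₂ ^ 2 = N) (hN : N ≠ 0)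
    (h : Int.gcd (x₁ * y₀ - x₀ * y₁) N = Int.gcd (x₂ * y₀ - x₀ * y₂) N) :
    N ∣ 2 * (x₁ * y₂ - x₂ * y₁) := by
  have cN : ∀ {x y : ℤ}, IsCoprime x y → x ^ 2 - D * y ^ 2 = N → IsCoprime y N := by
    intro x y c e
    have : IsCoprime y (x ^ 2 + y * (-(D * y))) := (c.symm.pow_right).add_mul_left_right _
    rwa [show x ^ 2 + y * (-(D * y)) = N by rw [← e]; ring] at this
  have k₀ := cN c₀ h₀
  have k₁ := cN c₁ h₁
  obtain ⟨d, hd⟩ : ∃ d : ℤ, d = Int.gcd (x₁ * y₀ - x₀ * y₁) N := ⟨_, rfl⟩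
  have hdN : d ∣ N := hd ▸ Int.gcd_dvd_right _ _
  have hd1 : d ∣ x₁ * y₀ - x₀ * y₁ := hd ▸ Int.gcd_dvd_left _ _
  have hd2 : d ∣ x₂ * y₀ - x₀ * y₂ := by rw [hd, h]; exact Int.gcd_dvd_left _ _
  obtain ⟨n, hn⟩ := hdN
  have hd0 : d ≠ 0 := by rintro rfl; simp at hn; exact hN hn
  have key : ∀ {x y : ℤ}, x ^ 2 - D * y ^ 2 = N → d = Int.gcd (x * y₀ - x₀ * y) N →
      n ∣ x * y₀ + x₀ * y := by
    intro x y e hg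
    obtain ⟨a, ha⟩ : d ∣ x * y₀ - x₀ * y := hg ▸ Int.gcd_dvd_left _ _
    have hco : IsCoprime n a := by
      have hb := Int.gcd_eq_gcd_ab (x * y₀ - x₀ * y) N
      rw [← hg] at hb
      refine ⟨Int.gcdB (x * y₀ - x₀ * y) N, Int.gcdA (x * y₀ - x₀ * y) N,
        mul_left_cancel₀ hd0 ?_⟩
      rw [mul_one]
      linear_combination -hb - Int.gcdA (x * y₀ - x₀ * y) N * ha -
        Int.gcdB (x * y₀ - x₀ * y) N * hn
    refine hco.dvd_of_dvd_mul_left ⟨y₀ ^ 2 - y ^ 2, mul_left_cancel₀ hd0 ?_⟩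
    have e1 : (x * y₀ - x₀ * y) * (x * y₀ + x₀ * y) = N * (y₀ ^ 2 - y ^ 2) := by
      linear_combination y₀ ^ 2 * e - y ^ 2 * h₀
    rw [ha] at e1
    linear_combination e1 + (y₀ ^ 2 - y ^ 2) * hn
  have hn1 := key h₁ hd
  have hn2 := key h₂ (hd.trans (by rw [h]))
  have kd : IsCoprime d y₀ := (k₀.of_isCoprime_of_dvd_right ⟨n, hn⟩).symm
  have kn : IsCoprime n y₀ := (k₀.of_isCoprime_of_dvd_right ⟨d, by rw [hn]; ring⟩).symm
  have hdw : d ∣ x₁ * y₂ - x₂ * y₁ := by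
    refine kd.dvd_of_dvd_mul_left ?_
    rw [show y₀ * (x₁ * y₂ - x₂ * y₁) =
      y₂ * (x₁ * y₀ - x₀ * y₁) - y₁ * (x₂ * y₀ - x₀ * y₂) by ring]
    exact dvd_sub (hd1.mul_left _) (hd2.mul_left _)
  have hnw : n ∣ x₁ * y₂ - x₂ * y₁ := by
    refine kn.dvd_of_dvd_mul_left ?_
    rw [show y₀ * (x₁ * y₂ - x₂ * y₁) =
      y₂ * (x₁ * y₀ + x₀ * y₁) - y₁ * (x₂ * y₀ + x₀ * y₂) by ring]
    exact dvd_sub (hn1.mul_left _) (hn2.mul_left _)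
  obtain ⟨e, he⟩ : ∃ e : ℤ, e = Int.gcd d n := ⟨_, rfl⟩
  have hed : e ∣ d := he ▸ Int.gcd_dvd_left _ _
  have hen : e ∣ n := he ▸ Int.gcd_dvd_right _ _
  have heN : e ^ 2 ∣ N := by rw [hn, sq]; exact mul_dvd_mul hed hen
  have ke : IsCoprime e y₁ := (k₁.of_isCoprime_of_dvd_right ((dvd_pow_self e two_ne_zero).trans
    heN)).symm
  have ke0 : IsCoprime e y₀ := (k₀.of_isCoprime_of_dvd_right (hed.trans ⟨n, hn⟩)).symm
  have hex : e ∣ 2 * x₁ := by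
    refine ke0.dvd_of_dvd_mul_left ?_
    rw [show y₀ * (2 * x₁) = (x₁ * y₀ - x₀ * y₁) + (x₁ * y₀ + x₀ * y₁) by ring]
    exact dvd_add (hed.trans hd1) (hen.trans hn1)
  have he4D : e ^ 2 ∣ 4 * D := by
    refine (ke.pow (m := 2) (n := 2)).dvd_of_dvd_mul_left ?_
    rw [show y₁ ^ 2 * (4 * D) = (2 * x₁) ^ 2 - 4 * N by rw [← h₁]; ring]
    exact dvd_sub (pow_dvd_pow_of_dvd hex 2) (heN.mul_left _)
  have he2 : e ∣ 2 := by
    rcases Int.even_or_odd' e with ⟨f, hf | hf⟩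
    · rw [hf] at he4D ⊢
      have : f * f ∣ D := by
        rw [show (2 * f) ^ 2 = 4 * (f * f) by ring] at he4D
        exact Int.dvd_of_mul_dvd_mul_left (by norm_num) he4D
      simpa using mul_dvd_mul_left (2 : ℤ) ((hD f this).dvd (a := 1))
    · have c4 : IsCoprime (e ^ 2) (4 : ℤ) := by
        have : IsCoprime e (2 : ℤ) := ⟨1, -f, by rw [hf]; ring⟩
        simpa using this.pow (m := 2) (n := 2)
      have := c4.dvd_of_dvd_mul_left he4D
      rw [sq] at this
      exact (hD e this).dvd
  obtain ⟨q, hq⟩ := he2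
  have hb := Int.gcd_eq_gcd_ab d n
  rw [← he] at hb
  rw [hn, hq, hb]
  obtain ⟨s, hs⟩ := hdw
  obtain ⟨t, ht⟩ := hnw
  refine ⟨q * (Int.gcdA d n * t + Int.gcdB d n * s), ?_⟩
  linear_combination q * d * Int.gcdA d n * ht + q * n * Int.gcdB d n * hs

theorem pell_quotient {D N x₁ y₁ x₂ y₂ : ℤ} (h₁ : x₁ ^ 2 - D * y₁ ^ 2 = N)
    (h₂ : x₂ ^ 2 - D * y₂ ^ 2 = N) (hN : N ≠ 0) (h : N ∣ 2 * (x₁ * y₂ - x₂ * y₁)) :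
    ∃ U V : ℤ, 2 * (x₁ * x₂ - D * y₁ * y₂) = N * U ∧ 2 * (x₁ * y₂ - x₂ * y₁) = N * V ∧
      U ^ 2 - D * V ^ 2 = 4 := by
  obtain ⟨V, hV⟩ := h
  have e : (2 * (x₁ * x₂ - D * y₁ * y₂)) ^ 2 = N ^ 2 * (4 + D * V ^ 2) := by
    have : (2 * (x₁ * x₂ - D * y₁ * y₂)) ^ 2 - D * (2 * (x₁ * y₂ - x₂ * y₁)) ^ 2 =
        4 * (N * N) := by
      nth_rewrite 1 [← h₁]
      rw [← h₂]
      ring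
    rw [hV] at this
    linear_combination this
  obtain ⟨U, hU⟩ : N ∣ 2 * (x₁ * x₂ - D * y₁ * y₂) :=
    (Int.pow_dvd_pow_iff two_ne_zero).mp ⟨_, e⟩
  refine ⟨U, V, hU, hV, ?_⟩
  rw [hU] at e
  have hN2 : N ^ 2 ≠ 0 := pow_ne_zero 2 hN
  have := mul_left_cancel₀ hN2 (show N ^ 2 * U ^ 2 = N ^ 2 * (4 + D * V ^ 2) by
    linear_combination e)
  linear_combination this

theorem eq_of_pell_quotient_of_log_eq {D N x₁ y₁ x₂ y₂ : ℤ} (hD : 0 < D)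
    (h₁ : x₁ ^ 2 - D * y₁ ^ 2 = N) (h₂ : x₂ ^ 2 - D * y₂ ^ 2 = N) (hN : N ≠ 0)
    (h : N ∣ 2 * (x₁ * y₂ - x₂ * y₁))
    (hsign : 0 < (x₁ + y₁ * √D : ℝ) ↔ 0 < (x₂ + y₂ * √D : ℝ))
    (hlog : Int.log 2 |(x₁ + y₁ * √D : ℝ)| = Int.log 2 |(x₂ + y₂ * √D : ℝ)|) :
    x₁ = x₂ ∧ y₁ = y₂ := by
  obtain ⟨U, V, hU, -, -⟩ := pell_quotient h₁ h₂ hN h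
  have hDR : (0 : ℝ) < D := by exact_mod_cast hD
  have hs0 : 0 < √(D : ℝ) := Real.sqrt_pos.mpr hDR
  have hs2 : √(D : ℝ) ^ 2 = D := Real.sq_sqrt hDR.le
  have hNR : (N : ℝ) ≠ 0 := by exact_mod_cast hN
  have e₁ : (x₁ : ℝ) ^ 2 - D * y₁ ^ 2 = N := by exact_mod_cast h₁
  have e₂ : (x₂ : ℝ) ^ 2 - D * y₂ ^ 2 = N := by exact_mod_cast h₂
  have eU : 2 * ((x₁ : ℝ) * x₂ - D * y₁ * y₂) = N * U := by exact_mod_cast hU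
  generalize √(D : ℝ) = s at *
  set a : ℝ := x₁ + y₁ * s with ha
  set b : ℝ := x₂ + y₂ * s with hb
  have ea : a * (x₁ - y₁ * s) = N := by
    rw [ha]; linear_combination e₁ - (y₁ : ℝ) ^ 2 * hs2
  have eb : b * (x₂ - y₂ * s) = N := by
    rw [hb]; linear_combination e₂ - (y₂ : ℝ) ^ 2 * hs2
  have ha0 : a ≠ 0 := by intro h0; rw [h0, zero_mul] at ea; exact hNR ea.symm
  have hb0 : b ≠ 0 := by intro h0; rw [h0, zero_mul] at eb; exact hNR eb.symm
  have hab : 0 < a * b := by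
    rcases lt_or_gt_of_ne ha0 with h | h
    · have : ¬ 0 < b := fun hb' => h.not_gt (hsign.mpr hb')
      exact mul_pos_of_neg_of_neg h (lt_of_le_of_ne (not_lt.mp this) hb0)
    · exact mul_pos h (hsign.mp h)
  have hsum : a ^ 2 + b ^ 2 = U * (a * b) := by
    have t : N * (a ^ 2 + b ^ 2) = N * (U * (a * b)) := by
      have : (N : ℝ) * (U * (a * b)) = a * b * (2 * (x₁ * x₂ - D * y₁ * y₂)) := by
        rw [eU]; ring
      rw [this]
      nth_rewrite 1 [mul_add]
      nth_rewrite 1 [← eb]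
      rw [← ea, ← hs2, ha, hb]
      ring
    exact mul_left_cancel₀ hNR t
  have hwin : ∀ u v : ℝ, u ≠ 0 → v ≠ 0 → Int.log 2 |u| = Int.log 2 |v| → |u| < 2 * |v| := by
    intro u v hu hv e
    have q1 := Int.lt_zpow_succ_log_self (b := 2) one_lt_two |u|
    have q2 := Int.zpow_log_le_self (b := 2) one_lt_two (abs_pos.mpr hv)
    rw [e, zpow_add_one₀ (by norm_num)] at q1
    push_cast at q1 q2
    linarith
  have w1 := hwin a b ha0 hb0 hlog
  have w2 := hwin b a hb0 ha0 hlog.symm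
  have habs : |a| * |b| = a * b := by rw [← abs_mul, abs_of_pos hab]
  have hU3 : U < 3 := by
    by_contra hge
    have : (3 : ℝ) ≤ U := by exact_mod_cast not_lt.mp hge
    have t : 3 * (a * b) ≤ a ^ 2 + b ^ 2 := by
      rw [hsum]; exact mul_le_mul_of_nonneg_right this hab.le
    rw [← habs, ← sq_abs a, ← sq_abs b] at t
    have pa := abs_pos.mpr ha0
    have pb := abs_pos.mpr hb0
    nlinarith [mul_pos (sub_pos.mpr w1) (sub_pos.mpr w2), mul_pos pa pb]
  have hU2 : (U : ℝ) ≤ 2 := by exact_mod_cast (by omega : U ≤ 2)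
  have hEq : a = b := by
    have : (a - b) ^ 2 ≤ 0 := by nlinarith [mul_le_mul_of_nonneg_right hU2 hab.le]
    have := pow_eq_zero_iff two_ne_zero |>.mp (le_antisymm this (sq_nonneg _))
    linarith
  have hconj : (x₁ - y₁ * s : ℝ) = x₂ - y₂ * s :=
    mul_left_cancel₀ ha0 (by rw [ea, hEq, eb])
  have hx : (x₁ : ℝ) = x₂ := by linarith
  have hy : (y₁ : ℝ) = y₂ := mul_right_cancel₀ hs0.ne' (by linarith)
  exact ⟨by exact_mod_cast hx, by exact_mod_cast hy⟩

theorem card_le_of_pell_quotient_of_neg {D N : ℤ} (hD : D < 0) (hN : N ≠ 0)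
    (F : Finset (ℤ × ℤ)) (hF : ∀ p ∈ F, p.1 ^ 2 - D * p.2 ^ 2 = N)
    (hFF : ∀ p ∈ F, ∀ q ∈ F, N ∣ 2 * (p.1 * q.2 - q.1 * p.2)) : F.card ≤ 25 := by
  rcases F.eq_empty_or_nonempty with rfl | ⟨p, hp⟩
  · simp
  have hsmall : ∀ z : ℤ, z ^ 2 ≤ 4 → z ∈ Finset.Icc (-2 : ℤ) 2 := by
    intro z hz
    rw [Finset.mem_Icc]
    constructor <;> nlinarith
  have := Finset.card_le_card_of_injOn
    (s := F) (t := Finset.Icc (-2 : ℤ) 2 ×ˢ Finset.Icc (-2 : ℤ) 2)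
    (fun q => (2 * (p.1 * q.1 - D * p.2 * q.2) / N, 2 * (p.1 * q.2 - q.1 * p.2) / N)) ?_ ?_
  · simpa using this
  · intro q hq
    obtain ⟨U, V, hU, hV, hUV⟩ := pell_quotient (hF p hp) (hF q hq) hN (hFF p hp q hq)
    simp only [hU, hV, Int.mul_ediv_cancel_left _ hN, Finset.coe_product, Set.mem_prod,
      Finset.mem_coe]
    exact ⟨hsmall U (by nlinarith [sq_nonneg V]), hsmall V (by nlinarith [sq_nonneg V, sq_nonneg U])⟩
  · intro q hq r hr hqr
    obtain ⟨U, V, hU, hV, -⟩ := pell_quotient (hF p hp) (hF q hq) hN (hFF p hp q hq)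
    obtain ⟨U', V', hU', hV', -⟩ := pell_quotient (hF p hp) (hF r hr) hN (hFF p hp r hr)
    simp only [hU, hV, hU', hV', Int.mul_ediv_cancel_left _ hN, Prod.mk.injEq] at hqr
    obtain ⟨rfl, rfl⟩ := hqr
    have e := hF p hp
    have h2N : 2 * N ≠ 0 := mul_ne_zero two_ne_zero hN
    refine Prod.ext (mul_left_cancel₀ h2N ?_) (mul_left_cancel₀ h2N ?_)
    · linear_combination p.1 * (hU - hU') + D * p.2 * (hV - hV') - 2 * (q.1 - r.1) * e
    · linear_combination p.2 * (hU - hU') + p.1 * (hV - hV') - 2 * (q.2 - r.2) * e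

theorem card_le_of_pell_quotient_of_pos {D N : ℤ} (hD : 0 < D) (hN : N ≠ 0) {T : ℝ} {n : ℕ}
    (hDT : (D : ℝ) ≤ T) (hn : 2 * T ^ 2 ≤ 2 ^ n)
    (F : Finset (ℤ × ℤ)) (hF : ∀ p ∈ F, p.1 ^ 2 - D * p.2 ^ 2 = N)
    (hFT : ∀ p ∈ F, |(p.1 : ℝ)| ≤ T ∧ |(p.2 : ℝ)| ≤ T)
    (hFF : ∀ p ∈ F, ∀ q ∈ F, N ∣ 2 * (p.1 * q.2 - q.1 * p.2)) :
    F.card ≤ 2 * (2 * n + 1) := by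
  have hD1 : (1 : ℝ) ≤ D := by exact_mod_cast hD
  have hs2 : √(D : ℝ) ^ 2 = D := Real.sq_sqrt (by linarith)
  have hs0 : 0 ≤ √(D : ℝ) := Real.sqrt_nonneg _
  have hsT : √(D : ℝ) ≤ T := (Real.sqrt_le_self_iff.mpr (Or.inr hD1)).trans hDT
  have hT1 : 1 ≤ T := hD1.trans hDT
  have := Finset.card_le_card_of_injOn
    (s := F) (t := (Finset.univ : Finset Prop) ×ˢ Finset.Icc (-n : ℤ) n)
    (fun q => ((0 : ℝ) < q.1 + q.2 * √D, Int.log 2 |(q.1 + q.2 * √D : ℝ)|)) ?_ ?_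
  · refine this.trans (le_of_eq ?_)
    rw [Finset.card_product, Finset.card_univ, Fintype.card_prop, Int.card_Icc]
    congr 1
    omega
  · intro q hq
    obtain ⟨hx, hy⟩ := hFT q hq
    have hys : |(q.2 : ℝ) * √D| ≤ T ^ 2 := by
      rw [abs_mul, abs_of_nonneg hs0, sq]
      exact mul_le_mul hy hsT hs0 (by linarith)
    have e : ((q.1 : ℝ) + q.2 * √D) * (q.1 - q.2 * √D) = N := by
      have : (q.1 : ℝ) ^ 2 - D * q.2 ^ 2 = N := by exact_mod_cast hF q hq
      linear_combination this - (q.2 : ℝ) ^ 2 * hs2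
    have hTT : T ≤ T ^ 2 := by nlinarith
    have up : |(q.1 : ℝ) + q.2 * √D| ≤ 2 ^ n := by
      linarith [abs_add_le (q.1 : ℝ) (q.2 * √D)]
    have up' : |(q.1 : ℝ) - q.2 * √D| ≤ 2 ^ n := by
      linarith [abs_sub (q.1 : ℝ) (q.2 * √D)]
    have up'' : |(q.1 : ℝ) + q.2 * √D| ≤ ((2 : ℕ) : ℝ) ^ (n : ℤ) := by simpa using up
    have hN1 : (1 : ℝ) ≤ |(N : ℝ)| := by exact_mod_cast Int.one_le_abs hN
    rw [← e, abs_mul] at hN1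
    have h0 : 0 < |(q.1 : ℝ) + q.2 * √D| :=
      pos_of_mul_pos_left (by linarith) (abs_nonneg ((q.1 : ℝ) - q.2 * √D))
    have low : ((2 : ℕ) : ℝ) ^ (-n : ℤ) ≤ |(q.1 : ℝ) + q.2 * √D| := by
      rw [zpow_neg, zpow_natCast, Nat.cast_ofNat, inv_le_iff_one_le_mul₀ (by positivity)]
      exact hN1.trans (mul_le_mul_of_nonneg_left up' h0.le)
    simp only [Finset.coe_product, Set.mem_prod, Finset.mem_coe, Finset.mem_univ, true_and,
      Finset.mem_Icc]
    refine ⟨?_, ?_⟩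
    · rw [← Int.log_zpow (R := ℝ) one_lt_two (-n : ℤ)]
      exact Int.log_mono_right (by positivity) low
    · rw [← Int.log_zpow (R := ℝ) one_lt_two (n : ℤ)]
      exact Int.log_mono_right h0 up''
  · intro q hq r hr hqr
    simp only [Prod.mk.injEq] at hqr
    obtain ⟨h1, h2⟩ := eq_of_pell_quotient_of_log_eq hD (hF q hq) (hF r hr) hN (hFF q hq r hr)
      (iff_of_eq hqr.1) hqr.2
    exact Prod.ext h1 h2

theorem card_primitive_solutions_le_s7 {D N : ℤ} (hD : Squarefree D) (hN : N ≠ 0) {T : ℝ} {n : ℕ}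
    (hDT : (D : ℝ) ≤ T) (hn : 2 * T ^ 2 ≤ 2 ^ n)
    (S : Finset (ℤ × ℤ)) (hS : ∀ p ∈ S, p.1 ^ 2 - D * p.2 ^ 2 = N)
    (hST : ∀ p ∈ S, |(p.1 : ℝ)| ≤ T ∧ |(p.2 : ℝ)| ≤ T)
    (hprim : ∀ p ∈ S, IsCoprime p.1 p.2) :
    S.card ≤ (4 * n + 27) * N.natAbs.divisors.card := by
  rcases S.eq_empty_or_nonempty with rfl | ⟨o, ho⟩
  · simp
  refine Finset.card_le_mul_card_image_of_maps_to
    (f := fun p => Int.gcd (p.1 * o.2 - o.1 * p.2) N) (fun p _ => ?_) _ fun d _ => ?_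
  · rw [Nat.mem_divisors]
    exact ⟨Int.natCast_dvd.mp (Int.gcd_dvd_right _ _), Int.natAbs_ne_zero.mpr hN⟩
  · set F := S.filter fun p => Int.gcd (p.1 * o.2 - o.1 * p.2) N = d with hF
    have hFS : F ⊆ S := Finset.filter_subset _ _
    have hFF : ∀ p ∈ F, ∀ q ∈ F, N ∣ 2 * (p.1 * q.2 - q.1 * p.2) := fun p hp q hq =>
      dvd_two_mul_cross_of_gcd_eq hD (hS o ho) (hS p (hFS hp)) (hprim o ho) (hprim p (hFS hp))
        (hS q (hFS hq)) hN
        ((Finset.mem_filter.mp hp).2.trans (Finset.mem_filter.mp hq).2.symm)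
    rcases lt_or_gt_of_ne hD.ne_zero with h | h
    · have := card_le_of_pell_quotient_of_neg h hN F (fun p hp => hS p (hFS hp)) hFF
      omega
    · have := card_le_of_pell_quotient_of_pos h hN hDT hn F (fun p hp => hS p (hFS hp))
        (fun p hp => hST p (hFS hp)) hFF
      omega

theorem card_solutions_le_s7 {D N : ℤ} (hD : Squarefree D) (hN : N ≠ 0) {T : ℝ} {n : ℕ}
    (hDT : (D : ℝ) ≤ T) (hn : 2 * T ^ 2 ≤ 2 ^ n)
    (S : Finset (ℤ × ℤ)) (hS : ∀ p ∈ S, p.1 ^ 2 - D * p.2 ^ 2 = N)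
    (hST : ∀ p ∈ S, |(p.1 : ℝ)| ≤ T ∧ |(p.2 : ℝ)| ≤ T) :
    S.card ≤ (4 * n + 27) * N.natAbs.divisors.card * N.natAbs.divisors.card := by
  have hgN : ∀ p ∈ S, ((Int.gcd p.1 p.2 : ℤ)) ^ 2 ∣ N := fun p hp => by
    rw [← hS p hp]
    exact dvd_sub (pow_dvd_pow_of_dvd (Int.gcd_dvd_left _ _) 2)
      ((pow_dvd_pow_of_dvd (Int.gcd_dvd_right _ _) 2).mul_left _)
  refine Finset.card_le_mul_card_image_of_maps_to
    (f := fun p => Int.gcd p.1 p.2) (fun p hp => ?_) _ fun g _ => ?_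
  · rw [Nat.mem_divisors]
    exact ⟨Int.natCast_dvd.mp ((dvd_pow_self _ two_ne_zero).trans (hgN p hp)),
      Int.natAbs_ne_zero.mpr hN⟩
  · set F := S.filter fun p => Int.gcd p.1 p.2 = g with hF
    have hFS : ∀ p ∈ F, p ∈ S := fun p hp => (Finset.mem_filter.mp hp).1
    have hFg : ∀ p ∈ F, Int.gcd p.1 p.2 = g := fun p hp => (Finset.mem_filter.mp hp).2
    rcases F.eq_empty_or_nonempty with h | ⟨o, ho⟩
    · simp [h]
    obtain ⟨M, hM⟩ := hgN o (hFS o ho)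
    rw [hFg o ho] at hM
    have hM0 : M ≠ 0 := by rintro rfl; simp at hM; exact hN hM
    have hg0 : (g : ℤ) ≠ 0 := by intro h0; rw [h0] at hM; simp at hM; exact hN hM
    have hgpos : 0 < g := by omega
    have hdiv : ∀ p ∈ F, (g : ℤ) * (p.1 / g) = p.1 ∧ (g : ℤ) * (p.2 / g) = p.2 := fun p hp =>
      ⟨Int.mul_ediv_cancel' (hFg p hp ▸ Int.gcd_dvd_left _ _),
        Int.mul_ediv_cancel' (hFg p hp ▸ Int.gcd_dvd_right _ _)⟩
    have hinj : Set.InjOn (fun p : ℤ × ℤ => (p.1 / (g : ℤ), p.2 / (g : ℤ))) F := by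
      intro p hp q hq hpq
      simp only [Prod.mk.injEq] at hpq
      obtain ⟨a1, a2⟩ := hdiv p hp
      obtain ⟨b1, b2⟩ := hdiv q hq
      exact Prod.ext (by rw [← a1, hpq.1, b1]) (by rw [← a2, hpq.2, b2])
    rw [← Finset.card_image_of_injOn hinj]
    have hle : ∀ x : ℤ, |((x / g : ℤ) : ℝ)| ≤ |(x : ℝ)| := fun x => by
      have := Int.natAbs_ediv_le_natAbs x g
      have : |x / (g : ℤ)| ≤ |x| := by
        rw [Int.abs_eq_natAbs, Int.abs_eq_natAbs]; exact_mod_cast this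
      exact_mod_cast this
    refine (card_primitive_solutions_le_s7 (N := M) hD hM0 hDT hn _ ?_ ?_ ?_).trans
      (Nat.mul_le_mul_left _ (Finset.card_le_card (Nat.divisors_subset_of_dvd
        (Int.natAbs_ne_zero.mpr hN) (Int.natAbs_dvd_natAbs.mpr ⟨_, hM.trans (mul_comm _ _)⟩))))
    · simp only [Finset.forall_mem_image]
      intro p hp
      obtain ⟨a1, a2⟩ := hdiv p hp
      have e := hS p (hFS p hp)
      rw [← a1, ← a2, hM] at e
      exact mul_left_cancel₀ (pow_ne_zero 2 hg0) (by linear_combination e)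
    · simp only [Finset.forall_mem_image]
      intro p hp
      obtain ⟨t1, t2⟩ := hST p (hFS p hp)
      exact ⟨(hle _).trans t1, (hle _).trans t2⟩
    · simp only [Finset.forall_mem_image]
      intro p hp
      rw [Int.isCoprime_iff_gcd_eq_one, ← hFg p hp]
      exact Int.gcd_ediv_gcd_ediv_gcd (by rw [hFg p hp]; exact hgpos)

/-- Uniformly in `D` and `N`, the equation `x² - D y² = N` has `≪ T^ε` solutions of size at
most `T`. -/
theorem card_pell_solutions_le_rpow (ε : ℝ) (hε : 0 < ε) :
    ∃ C : ℝ, 0 < C ∧ ∀ (T : ℝ) (D N : ℤ) (S : Finset (ℤ × ℤ)), 1 ≤ T → D ≠ 0 → N ≠ 0 →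
      |(D : ℝ)| ≤ T → |(N : ℝ)| ≤ T → (∀ p ∈ S, p.1 ^ 2 - D * p.2 ^ 2 = N) →
      (∀ p ∈ S, |(p.1 : ℝ)| ≤ T ∧ |(p.2 : ℝ)| ≤ T) → (S.card : ℝ) ≤ C * T ^ ε := by
  have hε3 : 0 < ε / 3 := by positivity
  obtain ⟨C, hC, hdiv⟩ := card_divisors_le_rpow (ε / 3) hε3
  have hl2 : 0 < Real.log 2 := Real.log_pos one_lt_two
  refine ⟨(35 + 16 / Real.log 2 / (ε / 3)) * C ^ 2, by positivity,
    fun T D N S hT hD hN hDT hNT hS hST => ?_⟩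
  have hT0 : 0 < T := by linarith
  obtain ⟨f, E, hE, hfE⟩ : ∃ f E : ℤ, Squarefree E ∧ f ^ 2 * E = D := by
    obtain ⟨a, b, hab, ha⟩ := Nat.sq_mul_squarefree D.natAbs
    refine ⟨b, D.sign * a, ?_, ?_⟩
    · rw [← Int.squarefree_natAbs, Int.natAbs_mul, Int.natAbs_sign_of_ne_zero hD]
      simpa using ha
    · have h : (b : ℤ) ^ 2 * a = D.natAbs := by exact_mod_cast hab
      linear_combination D.sign * h + Int.sign_mul_natAbs D
  have hf0 : f ≠ 0 := by rintro rfl; simp at hfE; exact hD hfE.symm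
  have hE0 : E ≠ 0 := hE.ne_zero
  have hDTZ : (|f| : ℝ) ≤ T ∧ (E : ℝ) ≤ T := by
    have h1 : 1 ≤ |f| := Int.one_le_abs hf0
    have h2 : 1 ≤ |E| := Int.one_le_abs hE0
    have h3 : |D| = |f| ^ 2 * |E| := by rw [← hfE, abs_mul, abs_pow]
    have h4 : |f| ≤ |D| := by rw [h3]; nlinarith
    have h5 : |E| ≤ |D| := by
      rw [h3]; exact le_mul_of_one_le_left (abs_nonneg _) (one_le_pow₀ h1)
    have h6 : (|f| : ℝ) ≤ |(D : ℝ)| := by exact_mod_cast h4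
    have h7 : (E : ℝ) ≤ |(D : ℝ)| := by exact_mod_cast (le_abs_self E).trans h5
    exact ⟨h6.trans hDT, h7.trans hDT⟩
  have hinj : Function.Injective fun p : ℤ × ℤ => (p.1, f * p.2) := by
    intro p q h
    simp only [Prod.mk.injEq] at h
    exact Prod.ext h.1 (mul_left_cancel₀ hf0 h.2)
  set n : ℕ := ⌊Real.logb 2 (2 * (T ^ 2) ^ 2)⌋₊ + 1 with hn
  have hn2 : 2 * (T ^ 2) ^ 2 ≤ (2 : ℝ) ^ n := by
    rw [← Real.rpow_natCast 2 n, ← Real.logb_le_iff_le_rpow one_lt_two (by positivity), hn]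
    push_cast
    exact (Nat.lt_floor_add_one _).le
  have hTT : T ≤ T ^ 2 := by nlinarith
  have hcard := card_solutions_le_s7 hE hN (hDTZ.2.trans hTT) hn2 (S.image fun p => (p.1, f * p.2))
    (by
      simp only [Finset.forall_mem_image]
      intro p hp
      rw [← hS p hp, ← hfE]; ring)
    (by
      simp only [Finset.forall_mem_image]
      intro p hp
      obtain ⟨t1, t2⟩ := hST p hp
      refine ⟨t1.trans hTT, ?_⟩
      push_cast
      rw [abs_mul, sq]
      exact mul_le_mul hDTZ.1 t2 (abs_nonneg _) hT0.le)
  rw [Finset.card_image_of_injective _ hinj] at hcard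
  have hτ : (N.natAbs.divisors.card : ℝ) ≤ C * T ^ (ε / 3) := by
    refine (hdiv _ (Int.natAbs_ne_zero.mpr hN)).trans ?_
    refine mul_le_mul_of_nonneg_left ?_ (by linarith)
    refine Real.rpow_le_rpow (Nat.cast_nonneg _) ?_ hε3.le
    rwa [Nat.cast_natAbs, Int.cast_abs]
  have hTε : 1 ≤ T ^ (ε / 3) := Real.one_le_rpow hT hε3.le
  have hnle : 4 * (n : ℝ) + 27 ≤ (35 + 16 / Real.log 2 / (ε / 3)) * T ^ (ε / 3) := by
    have hL : Real.logb 2 (2 * (T ^ 2) ^ 2) = 1 + 4 * (Real.log T / Real.log 2) := by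
      rw [Real.logb, Real.log_mul two_ne_zero (by positivity), ← pow_mul, Real.log_pow]
      field_simp
      push_cast
      ring
    have hlog0 : 0 ≤ Real.log T := Real.log_nonneg hT
    have h1 : (n : ℝ) ≤ 2 + 4 * (Real.log T / Real.log 2) := by
      have := Nat.floor_le (a := Real.logb 2 (2 * (T ^ 2) ^ 2)) (by rw [hL]; positivity)
      rw [hn]
      push_cast
      linarith
    have h2 : Real.log T / Real.log 2 ≤ T ^ (ε / 3) / (ε / 3) / Real.log 2 :=
      div_le_div_of_nonneg_right (Real.log_le_rpow_div hT0.le hε3) hl2.le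
    have h3 : (35 + 16 / Real.log 2 / (ε / 3)) * T ^ (ε / 3) =
        35 * T ^ (ε / 3) + 16 * (T ^ (ε / 3) / (ε / 3) / Real.log 2) := by
      field_simp
    linarith
  have hT3 : T ^ ε = T ^ (ε / 3) * T ^ (ε / 3) * T ^ (ε / 3) := by
    rw [← Real.rpow_add hT0, ← Real.rpow_add hT0]
    congr 1
    ring
  calc (S.card : ℝ) ≤ (4 * n + 27) * N.natAbs.divisors.card * N.natAbs.divisors.card := by
        exact_mod_cast hcard
    _ ≤ ((35 + 16 / Real.log 2 / (ε / 3)) * T ^ (ε / 3)) * (C * T ^ (ε / 3)) *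
        (C * T ^ (ε / 3)) := by gcongr
    _ = _ := by rw [hT3]; ring

theorem abs_le_of_mem_Eset1 {δ X : ℝ} (hX : 1 ≤ X) {A B m l : ℤ} (h : (A, B, m, l) ∈ Eset1 δ X) :
    |(A : ℝ)| ≤ 31 * X ^ ((1 : ℝ) / 3) ∧ |(m : ℝ)| ≤ 31 * X ^ ((1 : ℝ) / 3) ∧
      |(A : ℝ)| ^ 3 ≤ X ∧ |(B : ℝ)| ≤ X ∧ |(l : ℝ)| ≤ 31 * X := by
  obtain ⟨⟨-, -, hm, hl, hAX, hBX, -, heq⟩, hl3⟩ := h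
  dsimp only at hm hl hAX hBX heq hl3
  have hX0 : 0 < X := by linarith
  set c : ℝ := X ^ ((1 : ℝ) / 3) with hc
  have hc0 : 0 < c := Real.rpow_pos_of_pos hX0 _
  have hc3 : c ^ 3 = X := by
    rw [hc, ← Real.rpow_natCast, ← Real.rpow_mul hX0.le]
    norm_num
  have hAX' : |(A : ℝ)| ^ 3 ≤ X := by exact_mod_cast hAX
  have hAc : |(A : ℝ)| ≤ c := by
    rw [← hc3] at hAX'
    exact le_of_pow_le_pow_left₀ three_ne_zero hc0.le hAX'
  have hml : |(m : ℝ)| * (l : ℝ) ^ 2 ≤ 31 * X := by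
    have e : 4 * (A : ℝ) ^ 3 + 27 * (B : ℝ) ^ 2 = m * (l : ℝ) ^ 2 := by exact_mod_cast heq
    have h1 : |(m : ℝ)| * (l : ℝ) ^ 2 = |4 * (A : ℝ) ^ 3 + 27 * (B : ℝ) ^ 2| := by
      rw [e, abs_mul, abs_of_nonneg (sq_nonneg (l : ℝ))]
    rw [h1]
    refine (abs_add_le _ _).trans ?_
    rw [abs_mul, abs_mul, abs_pow, abs_of_nonneg (sq_nonneg (B : ℝ))]
    norm_num
    linarith
  have hl1 : (1 : ℝ) ≤ l := by exact_mod_cast hl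
  have hm1 : (1 : ℝ) ≤ |(m : ℝ)| := by exact_mod_cast Int.one_le_abs hm
  refine ⟨by linarith, ?_, hAX', ?_, ?_⟩
  · have h1 : c ^ 2 ≤ (l : ℝ) ^ 2 := pow_le_pow_left₀ hc0.le hl3.le 2
    have h2 : |(m : ℝ)| * c ^ 2 ≤ (31 * c) * c ^ 2 := by
      rw [show 31 * c * c ^ 2 = 31 * c ^ 3 by ring, hc3]
      exact (mul_le_mul_of_nonneg_left h1 (abs_nonneg _)).trans hml
    exact le_of_mul_le_mul_right h2 (by positivity)
  · refine le_trans ?_ hBX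
    rw [← sq_abs]
    rcases eq_or_ne B 0 with rfl | hB
    · simp
    · have : (1 : ℝ) ≤ |(B : ℝ)| := by exact_mod_cast Int.one_le_abs hB
      nlinarith
  · rw [abs_of_pos (by linarith)]
    nlinarith

/-- `#𝓔_δ^{(1)}(X) ≪ X^{2/3 + ε}` for fixed `δ ∈ (0, 1)` and `ε > 0`. -/
theorem Eset1_count (δ ε : ℝ) (hδ : δ ∈ Set.Ioo (0 : ℝ) 1) (hε : 0 < ε) :
    ∃ C : ℝ, 0 < C ∧ ∀ X : ℝ, 1 ≤ X →
      (Nat.card {t : ℤ × ℤ × ℤ × ℤ // t ∈ Eset1 δ X} : ℝ) ≤ C * X ^ (2 / 3 + ε) := by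
  classical
  obtain ⟨C, hC, hpell⟩ := card_pell_solutions_le_rpow ε hε
  refine ⟨C * 1000 ^ ε * 3969, by positivity, fun X hX => ?_⟩
  have hX0 : 0 < X := by linarith
  set c : ℝ := X ^ ((1 : ℝ) / 3) with hc
  have hc1 : 1 ≤ c := Real.one_le_rpow hX (by norm_num)
  have hcX : c ≤ X := by
    calc c ≤ X ^ (1 : ℝ) := Real.rpow_le_rpow_of_exponent_le hX (by norm_num)
      _ = X := Real.rpow_one X
  have hmem : ∀ (z : ℤ) (r : ℝ), |(z : ℝ)| ≤ r → z ∈ Finset.Icc (-(⌊r⌋₊ : ℤ)) ⌊r⌋₊ := by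
    intro z r h
    have : z.natAbs ≤ ⌊r⌋₊ := Nat.le_floor (by rwa [Nat.cast_natAbs, Int.cast_abs])
    rw [Finset.mem_Icc]
    omega
  set I := Finset.Icc (-(⌊31 * X⌋₊ : ℤ)) ⌊31 * X⌋₊ with hI
  set J := Finset.Icc (-(⌊31 * c⌋₊ : ℤ)) ⌊31 * c⌋₊ with hJ
  have hfin : (Eset1 δ X).Finite := by
    refine (I ×ˢ I ×ˢ I ×ˢ I).finite_toSet.subset ?_
    rintro ⟨A, B, m, l⟩ h
    obtain ⟨h1, h2, -, h4, h5⟩ := abs_le_of_mem_Eset1 hX h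
    simp only [Finset.mem_coe, Finset.mem_product]
    exact ⟨hmem _ _ (by linarith), hmem _ _ (by linarith), hmem _ _ (by linarith), hmem _ _ h5⟩
  set S := hfin.toFinset with hS
  have hcardS : Nat.card {t : ℤ × ℤ × ℤ × ℤ // t ∈ Eset1 δ X} = S.card :=
    Nat.card_eq_card_finite_toFinset hfin
  have hmaps : ∀ t ∈ S, (t.1, t.2.2.1) ∈ J ×ˢ J := by
    rintro ⟨A, B, m, l⟩ h
    obtain ⟨h1, h2, -⟩ := abs_le_of_mem_Eset1 hX (hfin.mem_toFinset.mp h)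
    exact Finset.mem_product.mpr ⟨hmem _ _ h1, hmem _ _ h2⟩
  have hfib : ∀ b ∈ J ×ˢ J, (S.filter fun t => (t.1, t.2.2.1) = b).card ≤
      ⌊C * (1000 * X) ^ ε⌋₊ := by
    rintro ⟨A, m⟩ -
    refine Nat.le_floor ?_
    set F := S.filter fun t => (t.1, t.2.2.1) = (A, m) with hF
    have hFS : ∀ t ∈ F, t ∈ Eset1 δ X ∧ t.1 = A ∧ t.2.2.1 = m := fun t ht => by
      obtain ⟨h1, h2⟩ := Finset.mem_filter.mp ht
      rw [Prod.mk.injEq] at h2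
      exact ⟨hfin.mem_toFinset.mp h1, h2⟩
    rcases F.eq_empty_or_nonempty with h | ⟨⟨A', B', m', l'⟩, ho⟩
    · rw [h, Finset.card_empty, Nat.cast_zero]
      positivity
    obtain ⟨hmemE, hA', hm'⟩ := hFS _ ho
    dsimp only at hA' hm'
    rw [hA', hm'] at hmemE
    obtain ⟨-, hm, hA3, -, -⟩ := abs_le_of_mem_Eset1 hX hmemE
    have hA0 : A ≠ 0 := hmemE.1.1
    have hm0 : m ≠ 0 := hmemE.1.2.2.1
    have hinj : Set.InjOn (fun t : ℤ × ℤ × ℤ × ℤ => (27 * t.2.1, t.2.2.2)) F := by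
      rintro ⟨A₁, B₁, m₁, l₁⟩ h₁ ⟨A₂, B₂, m₂, l₂⟩ h₂ h
      obtain ⟨-, r1, r2⟩ := hFS _ h₁
      obtain ⟨-, s1, s2⟩ := hFS _ h₂
      simp only [Prod.mk.injEq] at h r1 r2 s1 s2 ⊢
      omega
    rw [← Finset.card_image_of_injOn hinj]
    refine hpell (1000 * X) (27 * m) (-108 * A ^ 3) _ (by linarith) (by simpa using hm0)
      (by simpa using hA0) ?_ ?_ ?_ ?_
    · push_cast
      rw [abs_mul]
      norm_num
      linarith
    · push_cast
      rw [abs_mul, abs_pow]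
      norm_num
      linarith
    · simp only [Finset.forall_mem_image]
      rintro ⟨A₁, B, m₁, l⟩ h
      obtain ⟨h1, h2, h3⟩ := hFS _ h
      have e := h1.1.2.2.2.2.2.2.2
      dsimp only at h2 h3 e ⊢
      rw [h2, h3] at e
      linear_combination 27 * e
    · simp only [Finset.forall_mem_image]
      rintro ⟨A₁, B, m₁, l⟩ h
      obtain ⟨-, -, -, h4, h5⟩ := abs_le_of_mem_Eset1 hX (hFS _ h).1
      refine ⟨?_, by dsimp only; linarith⟩
      push_cast
      rw [abs_mul]
      norm_num
      linarith
  have hmain := Finset.card_le_mul_card_image_of_maps_to hmaps _ hfib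
  have hJcard : (J.card : ℝ) ≤ 63 * c := by
    have h1 : J.card = 2 * ⌊31 * c⌋₊ + 1 := by
      rw [hJ, Int.card_Icc]
      omega
    have h2 : (⌊31 * c⌋₊ : ℝ) ≤ 31 * c := Nat.floor_le (by positivity)
    rw [h1]
    push_cast
    linarith
  have hc2 : c * c = X ^ ((2 : ℝ) / 3) := by
    rw [hc, ← Real.rpow_add hX0]
    norm_num
  rw [hcardS]
  rw [Finset.card_product] at hmain
  calc (S.card : ℝ) ≤ ⌊C * (1000 * X) ^ ε⌋₊ * (J.card * J.card) := by exact_mod_cast hmain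
    _ ≤ (C * (1000 * X) ^ ε) * ((63 * c) * (63 * c)) := by
        gcongr
        exact Nat.floor_le (by positivity)
    _ = C * (1000 ^ ε * X ^ ε) * (3969 * (c * c)) := by
        rw [Real.mul_rpow (by norm_num) hX0.le]
        ring
    _ = C * 1000 ^ ε * 3969 * X ^ (2 / 3 + ε) := by
        rw [hc2, Real.rpow_add hX0]
        ring
end
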